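/- arXiv:2605.01682 — 2 statements merged into one kernel-verified Lean document; each statement's English description precedes it below -/
import Mathlib

section
/- (Rankin's trick bound) Let y ≥ 3, let P = ∏_{p < y} p be the product of all primes below y, and let x ≥ 3, λ = 1/log y. Then ∑_{d | P, d > x} 1/d ≤ x^{-λ} exp(∑_{p < y} p^{λ - 1}) ≪ (log y) · exp(-log x / log y). -/
open Finset

theorem sum_divisors_prod_primesBelow_rpow (y : ℕ) {a : ℝ} (ha : a ≠ 0) :
    ∑ d ∈ (∏ p ∈ Nat.primesBelow y, p).divisors, (d : ℝ) ^ a =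
      ∏ p ∈ Nat.primesBelow y, (1 + (p : ℝ) ^ a) := by
  let f : ArithmeticFunction ℝ := ⟨fun n => (n : ℝ) ^ a, by simp [ha]⟩
  have hf : f.IsMultiplicative :=
    ⟨by simp [f], fun {m n} _ => by
      simp [f, Real.mul_rpow (Nat.cast_nonneg m) (Nat.cast_nonneg n)]⟩
  have hprime : ∀ p ∈ Nat.primesBelow y, p.Prime := fun p hp => Nat.prime_of_mem_primesBelow hp
  have hsq : Squarefree (∏ p ∈ Nat.primesBelow y, p) := by
    refine Finset.squarefree_prod_of_pairwise_isCoprime (fun p hp q hq hpq => ?_)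
      fun p hp => (hprime p hp).squarefree
    exact Nat.coprime_iff_isRelPrime.mp ((Nat.coprime_primes (hprime p hp) (hprime q hq)).mpr hpq)
  have h := hf.prodPrimeFactors_one_add_of_squarefree hsq
  rw [Nat.primeFactors_prod hprime] at h
  exact h.symm

/-- Rankin's trick: each term with `x < d` is weighted by `(d / x) ^ l ≥ 1`. -/
theorem sum_one_div_filter_lt_le_rpow_mul_sum {s : Finset ℕ} {x l : ℝ} (hx : 0 < x) (hl : 0 ≤ l) :
    ∑ d ∈ s.filter (fun d : ℕ => x < (d : ℝ)), (1 : ℝ) / d ≤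
      x ^ (-l) * ∑ d ∈ s, (d : ℝ) ^ (l - 1) := by
  rw [Finset.mul_sum]
  refine (Finset.sum_le_sum fun d hd => ?_).trans
    (Finset.sum_le_sum_of_subset_of_nonneg (Finset.filter_subset _ _) fun d _ _ => by positivity)
  have hxd := (Finset.mem_filter.mp hd).2
  have hd0 : (0 : ℝ) < d := hx.trans hxd
  have hle : x ^ l ≤ (d : ℝ) ^ l := Real.rpow_le_rpow hx.le hxd.le hl
  have hxl : 0 < x ^ l := by positivity
  rw [Real.rpow_neg hx.le, Real.rpow_sub hd0, Real.rpow_one, ← mul_div_assoc]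
  gcongr
  rw [inv_mul_eq_div]
  exact (one_le_div hxl).mpr hle

theorem prod_primesBelow_pow_dvd_factorial (n : ℕ) :
    ∏ p ∈ Nat.primesBelow n, p ^ (n / p) ∣ n.factorial := by
  refine Finset.prod_dvd_of_isRelPrime (fun p hp q hq hpq => ?_) fun p hp => ?_
  · exact Nat.coprime_iff_isRelPrime.mp (Nat.Coprime.pow _ _
      ((Nat.coprime_primes (Nat.prime_of_mem_primesBelow hp)
        (Nat.prime_of_mem_primesBelow hq)).mpr hpq))
  · rw [(Nat.prime_of_mem_primesBelow hp).pow_dvd_factorial_iff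
      (show Nat.log p n < Nat.log p n + 2 by omega)]
    simpa using Finset.single_le_sum (f := fun i => n / p ^ i) (fun i _ => Nat.zero_le _)
      (show 1 ∈ Finset.Ico 1 (Nat.log p n + 2) by simp)

/-- The upper bound in the first theorem of Mertens. -/
theorem sum_primesBelow_log_div_le {n : ℕ} (hn : 0 < n) :
    ∑ p ∈ Nat.primesBelow n, Real.log p / p ≤ Real.log n + Real.log 4 := by
  have hn' : (0 : ℝ) < n := by exact_mod_cast hn
  have hprime : ∀ p ∈ Nat.primesBelow n, p.Prime := fun p hp => Nat.prime_of_mem_primesBelow hp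
  have hfact : ∑ p ∈ Nat.primesBelow n, ((n / p : ℕ) : ℝ) * Real.log p ≤ n * Real.log n := by
    have hle : ∏ p ∈ Nat.primesBelow n, p ^ (n / p) ≤ n ^ n :=
      (Nat.le_of_dvd n.factorial_pos (prod_primesBelow_pow_dvd_factorial n)).trans
        n.factorial_le_pow
    have hpos : 0 < ∏ p ∈ Nat.primesBelow n, p ^ (n / p) :=
      Finset.prod_pos fun p hp => pow_pos (hprime p hp).pos _
    have hlog := Real.log_le_log (Nat.cast_pos.mpr hpos) (Nat.cast_le (α := ℝ).mpr hle)
    push_cast at hlog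
    rw [Real.log_pow, Real.log_prod fun p hp =>
      pow_ne_zero _ (Nat.cast_ne_zero.mpr (hprime p hp).ne_zero)] at hlog
    simpa only [Real.log_pow] using hlog
  have htheta : ∑ p ∈ Nat.primesBelow n, Real.log p ≤ Real.log 4 * n := by
    refine le_trans ?_ (Chebyshev.theta_le_log4_mul_x hn'.le)
    rw [Chebyshev.theta_eq_sum_primesLE_log]
    refine Finset.sum_le_sum_of_subset_of_nonneg (fun p hp => ?_)
      fun p _ _ => Real.log_natCast_nonneg p
    exact Nat.mem_primesLE.mpr ⟨(Nat.lt_of_mem_primesBelow hp).le, hprime p hp⟩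
  have hterm : n * ∑ p ∈ Nat.primesBelow n, Real.log p / p ≤
      ∑ p ∈ Nat.primesBelow n, ((n / p : ℕ) : ℝ) * Real.log p +
        ∑ p ∈ Nat.primesBelow n, Real.log p := by
    rw [Finset.mul_sum, ← Finset.sum_add_distrib]
    refine Finset.sum_le_sum fun p hp => ?_
    have hfloor : (n : ℝ) / p ≤ (n / p : ℕ) + 1 := by
      rw [← Nat.floor_div_eq_div (K := ℝ)]
      exact (Nat.lt_floor_add_one _).le
    calc (n : ℝ) * (Real.log p / p) = n / p * Real.log p := by ring
      _ ≤ ((n / p : ℕ) + 1) * Real.log p :=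
        mul_le_mul_of_nonneg_right hfloor (Real.log_natCast_nonneg p)
      _ = _ := by ring
  refine le_of_mul_le_mul_left ?_ hn'
  linarith

theorem tsum_nat_rpow_neg_le {s : ℝ} (hs : 1 < s) :
    ∑' n : ℕ, (n : ℝ) ^ (-s) ≤ 1 + 1 / (s - 1) := by
  have hsum : Summable fun n : ℕ => (n : ℝ) ^ (-s) := Real.summable_nat_rpow.mpr (by linarith)
  have hanti : AntitoneOn (fun t : ℝ => t ^ (-s)) (Set.Ici ((1 : ℕ) : ℝ)) := fun a ha b _ hab =>
    Real.rpow_le_rpow_of_nonpos (by simp at ha; linarith) hab (by linarith)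
  have hint := hanti.tsum_comp_add_le_integral 1
    (by simpa using integrableOn_Ioi_rpow_of_lt (by linarith : -s < -1) one_pos)
    fun t ht => Real.rpow_nonneg (by simp at ht; linarith) _
  have hval : ∫ t in Set.Ioi ((1 : ℕ) : ℝ), t ^ (-s) = 1 / (s - 1) := by
    rw [Nat.cast_one, integral_Ioi_rpow_of_lt (by linarith) one_pos, Real.one_rpow,
      neg_div, ← div_neg]
    congr 1
    ring
  rw [hval] at hint
  rw [← hsum.sum_add_tsum_nat_add 2]
  have h0 : (0 : ℝ) ^ (-s) = 0 := Real.zero_rpow (by linarith)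
  simpa [Finset.sum_range_succ, h0, add_assoc, one_add_one_eq_two] using hint

/-- A bound for `exp (∑ f p)` through the Euler product of a nonnegative summable `f`. -/
theorem exp_sum_primesBelow_le_tsum (y : ℕ) (f : ℕ →* ℝ) (hf : ∀ n, 0 ≤ f n) (hsum : Summable f) :
    Real.exp (∑ p ∈ Nat.primesBelow y, f p) ≤ ∑' n : ℕ, f n := by
  calc Real.exp (∑ p ∈ Nat.primesBelow y, f p)
      ≤ ∏ p ∈ Nat.primesBelow y, (1 - f p)⁻¹ := by
        rw [Real.exp_sum]
        refine Finset.prod_le_prod (fun p _ => (Real.exp_pos _).le) fun p hp => ?_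
        have hlt : f p < 1 := (le_abs_self _).trans_lt
          (hsum.norm_lt_one (Nat.prime_of_mem_primesBelow hp).one_lt)
        rw [← inv_inv (Real.exp (f p)), ← Real.exp_neg]
        exact inv_anti₀ (sub_pos.mpr hlt) (Real.one_sub_le_exp_neg _)
    _ = ∑' m : y.smoothNumbers, f m :=
        EulerProduct.prod_primesBelow_geometric_eq_tsum_smoothNumbers hsum y
    _ ≤ ∑' n : ℕ, f n := hsum.tsum_subtype_le f _ hf

theorem exp_sum_primesBelow_rpow_neg_le (y : ℕ) {s : ℝ} (hs : 1 < s) :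
    Real.exp (∑ p ∈ Nat.primesBelow y, (p : ℝ) ^ (-s)) ≤ 1 + 1 / (s - 1) := by
  let f : ℕ →* ℝ :=
    { toFun := fun n => (n : ℝ) ^ (-s)
      map_one' := by simp
      map_mul' := fun m n => by
        simp [Real.mul_rpow (Nat.cast_nonneg m) (Nat.cast_nonneg n)] }
  have h := exp_sum_primesBelow_le_tsum y f (fun n => Real.rpow_nonneg (Nat.cast_nonneg n) _)
    (Real.summable_nat_rpow.mpr (by linarith))
  exact h.trans (tsum_nat_rpow_neg_le hs)

theorem exp_sub_exp_neg_le {u : ℝ} (h0 : 0 ≤ u) (h1 : u ≤ 1) :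
    Real.exp u - Real.exp (-u) ≤ 3 * u := by
  have h := (abs_le.mp (Real.abs_exp_sub_one_sub_id_le (abs_le.mpr ⟨by linarith, h1⟩))).2
  have h' := Real.add_one_le_exp (-u)
  nlinarith

theorem rpow_sub_one_le_rpow_neg_add {t l : ℝ} (ht : 1 ≤ t) (hl : 0 ≤ l)
    (hlt : l * Real.log t ≤ 1) :
    t ^ (l - 1) ≤ t ^ (-(1 + l)) + 3 * l * (Real.log t / t) := by
  have ht0 : 0 < t := by linarith
  have h := exp_sub_exp_neg_le (mul_nonneg hl (Real.log_nonneg ht)) hlt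
  have h1 : t ^ (l - 1) = Real.exp (l * Real.log t) / t := by
    rw [Real.rpow_sub ht0, Real.rpow_one, Real.rpow_def_of_pos ht0, mul_comm l]
  have h2 : t ^ (-(1 + l)) = Real.exp (-(l * Real.log t)) / t := by
    rw [show -(1 + l) = -l - 1 by ring, Real.rpow_sub ht0, Real.rpow_one,
      Real.rpow_def_of_pos ht0]
    ring_nf
  rw [h1, h2, ← mul_div_assoc, ← add_div]
  gcongr
  linarith

theorem exp_sum_primesBelow_rpow_le {y : ℕ} (hlog : 1 ≤ Real.log y) :
    Real.exp (∑ p ∈ Nat.primesBelow y, (p : ℝ) ^ (1 / Real.log y - 1)) ≤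
      2 * Real.exp (3 * (1 + Real.log 4)) * Real.log y := by
  have hy : 0 < y := Nat.pos_of_ne_zero (by rintro rfl; norm_num at hlog)
  have hL : 0 < Real.log y := by linarith
  have hl : 0 < 1 / Real.log y := by positivity
  have hsum : ∑ p ∈ Nat.primesBelow y, (p : ℝ) ^ (1 / Real.log y - 1) ≤
      ∑ p ∈ Nat.primesBelow y, (p : ℝ) ^ (-(1 + 1 / Real.log y)) + 3 * (1 + Real.log 4) := by
    calc _ ≤ ∑ p ∈ Nat.primesBelow y, ((p : ℝ) ^ (-(1 + 1 / Real.log y)) +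
            3 * (1 / Real.log y) * (Real.log p / p)) := by
          refine Finset.sum_le_sum fun p hp => ?_
          have hp1 : (1 : ℝ) ≤ p := by
            exact_mod_cast (Nat.prime_of_mem_primesBelow hp).one_lt.le
          refine rpow_sub_one_le_rpow_neg_add hp1 hl.le ?_
          rw [one_div_mul_eq_div, div_le_one hL]
          exact Real.log_le_log (by linarith)
            (by exact_mod_cast (Nat.lt_of_mem_primesBelow hp).le)
      _ = ∑ p ∈ Nat.primesBelow y, (p : ℝ) ^ (-(1 + 1 / Real.log y)) +
            3 * ((∑ p ∈ Nat.primesBelow y, Real.log p / p) / Real.log y) := by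
          rw [Finset.sum_add_distrib, ← Finset.mul_sum]
          ring
      _ ≤ _ := by
          gcongr
          rw [div_le_iff₀ hL]
          have h4 : 0 ≤ Real.log 4 := Real.log_nonneg (by norm_num)
          nlinarith [sum_primesBelow_log_div_le hy]
  have hzeta := exp_sum_primesBelow_rpow_neg_le y (s := 1 + 1 / Real.log y) (by linarith)
  rw [add_sub_cancel_left, one_div_one_div] at hzeta
  calc _ ≤ Real.exp (∑ p ∈ Nat.primesBelow y, (p : ℝ) ^ (-(1 + 1 / Real.log y))) *
          Real.exp (3 * (1 + Real.log 4)) := by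
        rw [← Real.exp_add]
        exact Real.exp_le_exp.mpr hsum
    _ ≤ (2 * Real.log y) * Real.exp (3 * (1 + Real.log 4)) := by
        gcongr
        linarith
    _ = _ := by ring

/-- Rankin's trick bound: for `y ≥ 3`, `P = ∏_{p < y} p`, `x ≥ 3` and `λ = 1/log y`,
`∑_{d ∣ P, d > x} 1/d ≤ x^{-λ} exp(∑_{p < y} p^{λ-1}) ≪ (log y) exp(-log x/log y)`. -/
theorem rankin_trick_bound :
    ∃ C > 0, ∀ y : ℕ, 3 ≤ y → ∀ x : ℝ, 3 ≤ x →
      (∑ d ∈ (∏ p ∈ Nat.primesBelow y, p).divisors.filter (fun d : ℕ => x < (d : ℝ)),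
          (1 : ℝ) / d) ≤
        x ^ (-(1 / Real.log y)) *
          Real.exp (∑ p ∈ Nat.primesBelow y, (p : ℝ) ^ (1 / Real.log y - 1)) ∧
      x ^ (-(1 / Real.log y)) *
          Real.exp (∑ p ∈ Nat.primesBelow y, (p : ℝ) ^ (1 / Real.log y - 1)) ≤
        C * Real.log y * Real.exp (-(Real.log x / Real.log y)) := by
  refine ⟨2 * Real.exp (3 * (1 + Real.log 4)), by positivity, fun y hy x hx => ?_⟩
  have hx0 : 0 < x := by linarith
  have hlog : 1 < Real.log y := by
    rw [Real.lt_log_iff_exp_lt (by positivity)]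
    exact Real.exp_one_lt_three.trans_le (by exact_mod_cast hy)
  have hl : 1 / Real.log y < 1 := (div_lt_one (by linarith)).mpr hlog
  constructor
  · refine (sum_one_div_filter_lt_le_rpow_mul_sum (l := 1 / Real.log y) hx0
      (by positivity)).trans ?_
    rw [sum_divisors_prod_primesBelow_rpow y (by linarith), Real.exp_sum]
    gcongr with p
    rw [add_comm]
    exact Real.add_one_le_exp _
  · have hxl : x ^ (-(1 / Real.log y)) = Real.exp (-(Real.log x / Real.log y)) := by
      rw [Real.rpow_def_of_pos hx0]
      ring_nf
    rw [hxl, mul_comm]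
    gcongr
    exact exp_sum_primesBelow_rpow_le hlog.le
end

section
/- (Mertens with error term) There is an absolute constant c and a positive constant K₁ such that for all X ≥ 3, ∑_{p ≤ X} 1/p = log log X + c + O(e^{-K₁ √(log X)}), where the sum is over primes p ≤ X. -/
open Finset

open Complex Metric Set in
/-- A holomorphic function without zeros on a disc, bounded by `e ^ A` times its value at the
centre, is `f 0 * exp h` with `h` of controlled size. -/
theorem exists_eq_mul_exp_of_norm_le {f : ℂ → ℂ} {r A : ℝ} (hr : 0 < r) (hA : 0 < A)
    (hf : DifferentiableOn ℂ f (ball 0 r)) (h0 : ∀ z ∈ ball (0 : ℂ) r, f z ≠ 0)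
    (hb : ∀ z ∈ ball (0 : ℂ) r, ‖f z‖ ≤ ‖f 0‖ * Real.exp A) :
    ∃ h : ℂ → ℂ, DifferentiableOn ℂ h (ball 0 r) ∧
      (∀ z ∈ ball (0 : ℂ) r, deriv h z = deriv f z / f z) ∧
      ∀ z ∈ ball (0 : ℂ) r, ‖h z‖ ≤ 2 * A * ‖z‖ / (r - ‖z‖) := by
  have hd : DifferentiableOn ℂ (fun z ↦ deriv f z / f z) (ball 0 r) :=
    (hf.deriv isOpen_ball).div hf h0
  obtain ⟨g, hg⟩ := hd.isExactOn_ball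
  have hg' : ∀ z ∈ ball (0 : ℂ) r, HasDerivAt g (deriv f z / f z) z := hg
  have hmem : (0 : ℂ) ∈ ball (0 : ℂ) r := mem_ball_self hr
  have hconst : ∀ z ∈ ball (0 : ℂ) r, f z = f 0 * exp (g z - g 0) := by
    have hder : ∀ z ∈ ball (0 : ℂ) r, HasDerivAt (fun z ↦ f z * exp (-(g z - g 0))) 0 z := by
      intro z hz
      have h1 := (hf.differentiableAt (isOpen_ball.mem_nhds hz)).hasDerivAt
      refine (h1.mul (((hg' z hz).sub_const (g 0)).neg.cexp)).congr_deriv ?_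
      have := h0 z hz
      field_simp
      ring
    intro z hz
    have := (convex_ball (0 : ℂ) r).is_const_of_fderivWithin_eq_zero (𝕜 := ℂ)
      (fun w hw ↦ (hder w hw).differentiableAt.differentiableWithinAt) (fun w hw ↦ by
        rw [fderivWithin_of_isOpen isOpen_ball hw, (hder w hw).hasFDerivAt.fderiv]; simp) hz hmem
    simp only [sub_self, neg_zero, exp_zero, mul_one] at this
    rw [← this, mul_assoc, ← exp_add]; simp
  refine ⟨fun z ↦ g z - g 0, ?_, ?_, ?_⟩
  · exact fun z hz ↦ ((hg' z hz).sub_const _).differentiableAt.differentiableWithinAt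
  · exact fun z hz ↦ ((hg' z hz).sub_const _).deriv
  · intro z hz
    refine borelCaratheodory_zero hA
      (fun z hz ↦ ((hg' z hz).sub_const _).differentiableAt.differentiableWithinAt) ?_ hr hz
      (by simp)
    intro w hw
    have h2 := hb w hw
    rw [hconst w hw, norm_mul, norm_exp] at h2
    exact Real.exp_le_exp.1 (le_of_mul_le_mul_left h2 (norm_pos_iff.2 (h0 0 hmem)))

open Complex Metric Set in
theorem norm_logDeriv_le_of_norm_le {f : ℂ → ℂ} {r A ρ δ : ℝ} (hA : 0 < A)
    (hρ : 0 ≤ ρ) (hδ : 0 < δ) (hr : ρ + δ < r)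
    (hf : DifferentiableOn ℂ f (ball 0 r)) (h0 : ∀ z ∈ ball (0 : ℂ) r, f z ≠ 0)
    (hb : ∀ z ∈ ball (0 : ℂ) r, ‖f z‖ ≤ ‖f 0‖ * Real.exp A) {z : ℂ} (hz : ‖z‖ ≤ ρ) :
    ‖deriv f z / f z‖ ≤ 2 * A * (ρ + δ) / (r - (ρ + δ)) / δ := by
  have hr0 : 0 < r := by linarith
  obtain ⟨h, hh, hd, hn⟩ := exists_eq_mul_exp_of_norm_le hr0 hA hf h0 hb
  have hzr : z ∈ ball (0 : ℂ) r := by rw [mem_ball_zero_iff]; linarith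
  have hsub : closedBall z δ ⊆ ball 0 r := by
    intro w hw
    rw [mem_closedBall, dist_eq_norm] at hw
    rw [mem_ball_zero_iff]
    have := norm_le_norm_sub_add w z
    linarith
  rw [← hd z hzr]
  refine norm_deriv_le_of_forall_mem_sphere_norm_le hδ ?_ ?_
  · exact (hh.mono hsub).diffContOnCl_ball subset_rfl
  · intro w hw
    have hw' := hw
    rw [mem_sphere, dist_eq_norm] at hw'
    have h3 : ‖w‖ ≤ ρ + δ := by
      have := norm_le_norm_sub_add w z
      linarith
    refine (hn w (hsub (sphere_subset_closedBall hw))).trans ?_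
    have : 0 < r - (ρ + δ) := by linarith
    gcongr

open Complex Metric Set in
theorem norm_logDeriv_zero_le_of_norm_le {f : ℂ → ℂ} {r A : ℝ} (hr : 0 < r) (hA : 0 < A)
    (hf : DifferentiableOn ℂ f (ball 0 r)) (h0 : ∀ z ∈ ball (0 : ℂ) r, f z ≠ 0)
    (hb : ∀ z ∈ ball (0 : ℂ) r, ‖f z‖ ≤ ‖f 0‖ * Real.exp A) :
    ‖deriv f 0 / f 0‖ ≤ 4 * A / r := by
  have := norm_logDeriv_le_of_norm_le (ρ := 0) (δ := r / 2) (z := 0) hA le_rfl (by linarith)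
    (by linarith) hf h0 hb (by simp)
  convert this using 1
  rw [zero_add, sub_half]
  field_simp
  ring

open Complex Metric Set ComplexConjugate in
/-- Removing a zero with a Blaschke factor. -/
theorem exists_div_blaschkeFactor {f : ℂ → ℂ} {R M : ℝ} {ρ : ℂ}
    (hf : DiffContOnCl ℂ f (ball 0 R)) (hb : ∀ z ∈ sphere (0 : ℂ) R, ‖f z‖ ≤ M)
    (hρ : ‖ρ‖ < R) (hfρ : f ρ = 0) (hρ0 : ρ ≠ 0) :
    ∃ g : ℂ → ℂ, DiffContOnCl ℂ g (ball 0 R) ∧ (∀ z ∈ sphere (0 : ℂ) R, ‖g z‖ ≤ M) ∧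
      (∀ z, g z = 0 → z ∈ ball (0 : ℂ) R → f z = 0) ∧
      ‖g 0‖ = ‖f 0‖ * (R / ‖ρ‖) ∧
      (f 0 ≠ 0 → deriv f 0 / f 0 = deriv g 0 / g 0 + (conj ρ / R ^ 2 - 1 / ρ)) := by
  have hR : 0 < R := (norm_nonneg _).trans_lt hρ
  have hRC : (R : ℂ) ≠ 0 := by exact_mod_cast hR.ne'
  have hρm : ρ ∈ ball (0 : ℂ) R := by simpa using hρ
  have hfeq : ∀ z, f z = (z - ρ) * dslope f ρ z := fun z ↦ by
    have := sub_smul_dslope f ρ z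
    rw [hfρ, sub_zero, smul_eq_mul] at this
    exact this.symm
  have hds : DiffContOnCl ℂ (dslope f ρ) (ball 0 R) := by
    refine ⟨(differentiableOn_dslope (isOpen_ball.mem_nhds hρm)).2 hf.differentiableOn, ?_⟩
    refine (continuousOn_dslope
      (Filter.mem_of_superset (isOpen_ball.mem_nhds hρm) subset_closure)).2
      ⟨hf.continuousOn, hf.differentiableAt isOpen_ball hρm⟩
  have hlin : Differentiable ℂ fun z : ℂ ↦ (R ^ 2 - conj ρ * z) / R := by fun_prop
  have hnum : ∀ z ∈ ball (0 : ℂ) R, (R : ℂ) ^ 2 - conj ρ * z ≠ 0 := by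
    intro z hz h
    have h1 : ‖conj ρ * z‖ = R ^ 2 := by
      rw [← sub_eq_zero.1 h]; simp
    rw [norm_mul, RCLike.norm_conj] at h1
    rw [mem_ball_zero_iff] at hz
    nlinarith [norm_nonneg ρ, norm_nonneg z]
  refine ⟨fun z ↦ dslope f ρ z * ((R ^ 2 - conj ρ * z) / R),
    hds.smul hlin.diffContOnCl, ?_, ?_, ?_, ?_⟩
  · intro z hz
    have h1 := norm_canonicalFactor_eval_circle_eq_one hρm hz
    have hzρ : z - ρ ≠ 0 := by
      rintro h
      rw [sub_eq_zero.1 h, mem_sphere_zero_iff_norm] at hz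
      exact hρ.ne hz
    have h2 : dslope f ρ z * ((R ^ 2 - conj ρ * z) / R) = f z * canonicalFactor R ρ z := by
      rw [hfeq, canonicalFactor_apply]
      field_simp
    beta_reduce
    rw [h2, norm_mul, h1, mul_one]
    exact hb z hz
  · intro z hz hzR
    rw [hfeq]
    rcases mul_eq_zero.1 hz with h | h
    · rw [h, mul_zero]
    · exact absurd h (div_ne_zero (hnum z hzR) hRC)
  · have : ‖f 0‖ = ‖ρ‖ * ‖dslope f ρ 0‖ := by rw [hfeq]; simp
    rw [this]
    have : ‖ρ‖ ≠ 0 := norm_ne_zero_iff.2 hρ0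
    simp only [mul_zero, sub_zero, norm_mul, norm_div, norm_pow, norm_real, Real.norm_eq_abs,
      abs_of_pos hR]
    field_simp
  · intro hf0
    have h0m : (0 : ℂ) ∈ ball (0 : ℂ) R := mem_ball_self hR
    have hd0 : dslope f ρ 0 ≠ 0 := fun h ↦ hf0 (by rw [hfeq, h, mul_zero])
    have hD := (hds.differentiableAt isOpen_ball h0m).hasDerivAt
    have h1 : HasDerivAt f (1 * dslope f ρ 0 + (0 - ρ) * deriv (dslope f ρ) 0) 0 := by
      exact (((hasDerivAt_id (0 : ℂ)).sub_const ρ).mul hD).congr_of_eventuallyEq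
        (Filter.Eventually.of_forall hfeq)
    have h2 : HasDerivAt (fun z ↦ dslope f ρ z * ((R ^ 2 - conj ρ * z) / R))
        (deriv (dslope f ρ) 0 * ((R ^ 2 - conj ρ * 0) / R) +
          dslope f ρ 0 * ((0 - conj ρ * 1) / R)) 0 := by
      refine hD.mul ?_
      exact (((hasDerivAt_const (0 : ℂ) ((R : ℂ) ^ 2))).sub
        ((hasDerivAt_id (0 : ℂ)).const_mul (conj ρ))).div_const _
    rw [h1.deriv, h2.deriv, hfeq 0]
    field_simp
    ring

open Complex Metric Set ComplexConjugate in
theorem re_conj_div_sq_sub_inv_nonneg {R : ℝ} {ρ : ℂ} (hρ : ‖ρ‖ ≤ R) (hre : ρ.re ≤ 0) :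
    0 ≤ (conj ρ / R ^ 2 - 1 / ρ : ℂ).re := by
  rcases eq_or_ne ρ 0 with rfl | h
  · simp
  have h1 : 0 < normSq ρ := normSq_pos.2 h
  have h2 : normSq ρ ≤ R ^ 2 := by
    rw [normSq_eq_norm_sq]; gcongr
  have : (conj ρ / R ^ 2 - 1 / ρ : ℂ).re = (-ρ.re) * (1 / normSq ρ - 1 / R ^ 2) := by
    rw [← ofReal_pow, sub_re, div_ofReal_re, one_div, inv_re, conj_re]; ring
  rw [this]
  have : 1 / R ^ 2 ≤ 1 / normSq ρ := one_div_le_one_div_of_le h1 h2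
  exact mul_nonneg (by linarith) (by linarith)

open Complex Metric Set in
/-- A lower bound for the real part of the logarithmic derivative at the centre of a disc, all of
whose zeros lie in the left half. -/
theorem neg_le_re_logDeriv {f : ℂ → ℂ} {r R M A : ℝ} (hr : 0 < r) (hrR : r < R) (hA : 0 < A)
    (hf : DiffContOnCl ℂ f (ball 0 R)) (hb : ∀ z ∈ sphere (0 : ℂ) R, ‖f z‖ ≤ M)
    (hM : M ≤ ‖f 0‖ * Real.exp A) (hf0 : f 0 ≠ 0)
    (hz : ∀ z ∈ ball (0 : ℂ) R, f z = 0 → z.re ≤ 0) :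
    -(4 * A / r) ≤ (deriv f 0 / f 0).re := by
  have hR : 0 < R := hr.trans hrR
  have hq : 1 < R / r := (one_lt_div hr).2 hrR
  obtain ⟨n, hn⟩ := pow_unbounded_of_one_lt (M / ‖f 0‖) hq
  rw [div_lt_iff₀' (norm_pos_iff.2 hf0)] at hn
  induction n generalizing f with
  | zero =>
    have := norm_le_of_forall_mem_frontier_norm_le isBounded_ball hf (C := M) (z := 0)
      (by rwa [frontier_ball _ hR.ne']) (subset_closure (mem_ball_self hR))
    simp at hn
    linarith
  | succ n ih =>
    by_cases hzero : ∃ ρ ∈ ball (0 : ℂ) r, f ρ = 0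
    · obtain ⟨ρ, hρ, hfρ⟩ := hzero
      rw [mem_ball_zero_iff] at hρ
      have hρ0 : ρ ≠ 0 := by rintro rfl; exact hf0 hfρ
      have hρn : 0 < ‖ρ‖ := norm_pos_iff.2 hρ0
      obtain ⟨g, hg, hgb, hgz, hg0, hgd⟩ :=
        exists_div_blaschkeFactor hf hb (hρ.trans hrR) hfρ hρ0
      have hge : ‖f 0‖ * (R / r) ≤ ‖g 0‖ := by rw [hg0]; gcongr
      have hge' : ‖f 0‖ ≤ ‖g 0‖ := le_trans (le_mul_of_one_le_right (norm_nonneg _) hq.le) hge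
      have hg0' : g 0 ≠ 0 := norm_pos_iff.1 ((norm_pos_iff.2 hf0).trans_le hge')
      have h1 := ih hg hgb (hM.trans (by gcongr)) hg0'
        (fun z hzR h ↦ hz z hzR (hgz z h hzR)) (hn.trans_le (by
          rw [pow_succ', ← mul_assoc]; gcongr))
      rw [hgd hf0, add_re]
      have := re_conj_div_sq_sub_inv_nonneg (R := R) (hρ.trans hrR).le
        (hz ρ (by rw [mem_ball_zero_iff]; linarith) hfρ)
      linarith
    · push Not at hzero
      have h1 := norm_logDeriv_zero_le_of_norm_le hr hA
        (hf.differentiableOn.mono (ball_subset_ball hrR.le)) hzero (fun z hzr ↦ by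
          refine le_trans ?_ hM
          exact norm_le_of_forall_mem_frontier_norm_le isBounded_ball hf (C := M)
            (by rwa [frontier_ball _ hR.ne'])
            (subset_closure (ball_subset_ball hrR.le hzr)))
      have h2 := abs_re_le_norm (deriv f 0 / f 0)
      rw [abs_le] at h2
      linarith

open Complex Metric Set ComplexConjugate in
theorem neg_add_le_re_logDeriv_of_zero {f : ℂ → ℂ} {r R M A w : ℝ} (hr : 0 < r) (hrR : r < R)
    (hA : 0 < A) (hf : DiffContOnCl ℂ f (ball 0 R)) (hb : ∀ z ∈ sphere (0 : ℂ) R, ‖f z‖ ≤ M)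
    (hM : M ≤ ‖f 0‖ * Real.exp A) (hf0 : f 0 ≠ 0)
    (hz : ∀ z ∈ ball (0 : ℂ) R, f z = 0 → z.re ≤ 0) (hw : 0 < w) (hwR : w < R)
    (hfw : f (-w) = 0) :
    1 / w - w / R ^ 2 - 4 * A / r ≤ (deriv f 0 / f 0).re := by
  have hρ : ‖(-w : ℂ)‖ < R := by simpa [abs_of_pos hw] using hwR
  have hρ0 : (-w : ℂ) ≠ 0 := by simpa using hw.ne'
  obtain ⟨g, hg, hgb, hgz, hg0, hgd⟩ := exists_div_blaschkeFactor hf hb hρ hfw hρ0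
  have hge' : ‖f 0‖ ≤ ‖g 0‖ := by
    rw [hg0]
    exact le_mul_of_one_le_right (norm_nonneg _)
      ((one_le_div (norm_pos_iff.2 hρ0)).2 hρ.le)
  have h1 := neg_le_re_logDeriv hr hrR hA hg hgb (hM.trans (by gcongr))
    (norm_pos_iff.1 ((norm_pos_iff.2 hf0).trans_le hge'))
    (fun z hzR h ↦ hz z hzR (hgz z h hzR))
  rw [hgd hf0, add_re]
  have : (conj (-w : ℂ) / R ^ 2 - 1 / (-w : ℂ)).re = 1 / w - w / R ^ 2 := by
    have : (conj (-w : ℂ) / R ^ 2 - 1 / (-w : ℂ)) = ((1 / w - w / R ^ 2 : ℝ) : ℂ) := by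
      push_cast [map_neg, conj_ofReal]
      field_simp
      ring
    rw [this, ofReal_re]
  rw [this]
  linarith

/-- The fractional part function, truncated to `(1, ∞)`. -/
noncomputable def fractIoi (t : ℝ) : ℂ :=
  (Set.Ioi (1 : ℝ)).indicator (fun t ↦ ((Int.fract t : ℝ) : ℂ)) t

theorem norm_fractIoi_le (t : ℝ) : ‖fractIoi t‖ ≤ 1 := by
  rw [fractIoi, Set.indicator_apply]
  split_ifs with h
  · rw [Complex.norm_real, Real.norm_eq_abs, abs_of_nonneg (Int.fract_nonneg t)]
    exact (Int.fract_lt_one t).le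
  · simp

theorem measurable_fractIoi : Measurable fractIoi :=
  (Complex.measurable_ofReal.comp measurable_fract).indicator measurableSet_Ioi

open Complex Set MeasureTheory in
theorem mellin_fractIoi_eq (s : ℂ) :
    mellin fractIoi s = ∫ t in Ioi (1 : ℝ), (t : ℂ) ^ (s - 1) * ((Int.fract t : ℝ) : ℂ) := by
  have h : ∀ t : ℝ, (t : ℂ) ^ (s - 1) • fractIoi t =
      (Ioi (1 : ℝ)).indicator (fun t : ℝ ↦ (t : ℂ) ^ (s - 1) * ((Int.fract t : ℝ) : ℂ)) t := by
    intro t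
    simp only [fractIoi, indicator_apply]
    split_ifs <;> simp
  simp_rw [mellin, h]
  rw [setIntegral_indicator measurableSet_Ioi,
    Set.inter_eq_right.2 (Set.Ioi_subset_Ioi zero_le_one)]

open Complex Set MeasureTheory Filter in
theorem integrableOn_cpow_mul_fract {s : ℂ} (hs : s.re < 0) :
    IntegrableOn (fun t : ℝ ↦ (t : ℂ) ^ (s - 1) * ((Int.fract t : ℝ) : ℂ)) (Ioi 1) := by
  refine (integrableOn_Ioi_rpow_of_lt (show s.re - 1 < -1 by linarith) one_pos).mono' ?_ ?_
  · refine AEStronglyMeasurable.mul ?_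
      (Complex.measurable_ofReal.comp measurable_fract).aestronglyMeasurable
    refine ContinuousOn.aestronglyMeasurable (fun t ht ↦ ?_) measurableSet_Ioi
    exact (continuousAt_ofReal_cpow_const _ _ (Or.inr (one_pos.trans ht).ne')).continuousWithinAt
  · refine (ae_restrict_iff' measurableSet_Ioi).2 (Eventually.of_forall fun t ht ↦ ?_)
    have ht0 : (0 : ℝ) < t := one_pos.trans ht
    rw [norm_mul, norm_cpow_eq_rpow_re_of_pos ht0, norm_real, Real.norm_eq_abs,
      abs_of_nonneg (Int.fract_nonneg t)]
    simpa using mul_le_mul_of_nonneg_left (Int.fract_lt_one t).le (Real.rpow_nonneg ht0.le _)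

open Complex Set MeasureTheory Filter in
theorem norm_mellin_fractIoi_neg_le {s : ℂ} (hs : 0 < s.re) :
    ‖mellin fractIoi (-s)‖ ≤ 1 / s.re := by
  have h2 : ∫ t in Ioi (1 : ℝ), t ^ (-s.re - 1) = 1 / s.re := by
    rw [integral_Ioi_rpow_of_lt (by linarith) one_pos]
    simp
  rw [mellin_fractIoi_eq, ← h2]
  refine norm_integral_le_of_norm_le (integrableOn_Ioi_rpow_of_lt (by linarith) one_pos) ?_
  refine (ae_restrict_iff' measurableSet_Ioi).2 (Eventually.of_forall fun t ht ↦ ?_)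
  have ht0 : (0 : ℝ) < t := one_pos.trans ht
  rw [norm_mul, norm_cpow_eq_rpow_re_of_pos ht0, norm_real, Real.norm_eq_abs,
    abs_of_nonneg (Int.fract_nonneg t)]
  simpa using mul_le_mul_of_nonneg_left (Int.fract_lt_one t).le (Real.rpow_nonneg ht0.le _)

open Complex Set MeasureTheory Filter Topology Asymptotics in
theorem differentiableAt_mellin_fractIoi {s : ℂ} (hs : s.re < 0) :
    DifferentiableAt ℂ (mellin fractIoi) s := by
  refine mellin_differentiableAt_of_isBigO_rpow (a := 0) (b := s.re - 1) ?_ ?_ hs ?_ (by linarith)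
  · refine LocallyIntegrable.locallyIntegrableOn (fun x ↦ ⟨Icc (x - 1) (x + 1),
      Icc_mem_nhds (by linarith) (by linarith), ?_⟩) _
    exact Measure.integrableOn_of_bounded (M := 1) (by simp)
      measurable_fractIoi.aestronglyMeasurable (Eventually.of_forall norm_fractIoi_le)
  · refine IsBigO.of_bound 1 (Eventually.of_forall fun t ↦ ?_)
    simpa using norm_fractIoi_le t
  · refine (isBigO_zero _ _).congr' ?_ EventuallyEq.rfl
    filter_upwards [nhdsWithin_le_nhds (Iio_mem_nhds (zero_lt_one (α := ℝ)))] with t ht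
    rw [fractIoi, indicator_of_notMem (by simpa using le_of_lt ht)]

open Complex Set MeasureTheory Filter Asymptotics in
theorem riemannZeta₁_eq_of_one_lt_re {s : ℂ} (hs : 1 < s.re) :
    riemannZeta₁ s = s - s * (s - 1) * mellin fractIoi (-s) := by
  have hs1 : s - 1 ≠ 0 := fun h ↦ by simp [sub_eq_zero.1 h] at hs
  have h1 := LSeries_eq_mul_integral_of_nonneg (fun _ ↦ 1) zero_le_one hs (by
    simpa using isBigO_refl _ _) (by simp)
  have h2 : ∫ t in Ioi (1 : ℝ), (∑ k ∈ Finset.Icc 1 ⌊t⌋₊, ((1 : ℝ) : ℂ)) * (t : ℂ) ^ (-(s + 1)) =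
      1 / (s - 1) - mellin fractIoi (-s) := by
    have h3 : ∫ t in Ioi (1 : ℝ), (t : ℂ) ^ (-s) = 1 / (s - 1) := by
      rw [integral_Ioi_cpow_of_lt (by simpa using hs) one_pos]
      rw [ofReal_one, one_cpow, neg_div, ← div_neg]
      congr 1; ring
    rw [mellin_fractIoi_eq, ← h3, ← integral_sub
      (integrableOn_Ioi_cpow_of_lt (by simpa using hs) one_pos)
      (integrableOn_cpow_mul_fract (by rw [neg_re]; linarith))]
    refine setIntegral_congr_fun measurableSet_Ioi fun t ht ↦ ?_
    have ht0 : (0 : ℝ) < t := one_pos.trans ht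
    have ht' : (t : ℂ) ≠ 0 := by exact_mod_cast ht0.ne'
    have h4 : (⌊t⌋₊ : ℂ) = t - ((Int.fract t : ℝ) : ℂ) := by
      rw [← ofReal_sub, Int.self_sub_fract, ← natCast_floor_eq_intCast_floor ht0.le]
      simp
    have h5 : (t : ℂ) ^ (-s) = t * t ^ (-s - 1) := by
      rw [cpow_sub _ _ ht', cpow_one]; field_simp
    simp only [ofReal_one, Finset.sum_const, Nat.card_Icc, add_tsub_cancel_right, nsmul_eq_mul,
      mul_one]
    rw [h4, h5, neg_add']
    ring
  rw [h2] at h1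
  have h6 : LSeries (fun _ ↦ ((1 : ℝ) : ℂ)) s = riemannZeta s := by
    rw [← LSeries_one_eq_riemannZeta hs]; simp; rfl
  rw [h6, riemannZeta_eq_inv_sub_mul (sub_ne_zero.1 hs1)] at h1
  field_simp at h1
  rw [h1]; ring

open Complex Set Filter in
theorem riemannZeta₁_eq {s : ℂ} (hs : 0 < s.re) :
    riemannZeta₁ s = s - s * (s - 1) * mellin fractIoi (-s) := by
  have hU : IsOpen {s : ℂ | 0 < s.re} := isOpen_lt continuous_const continuous_re
  have hd : DifferentiableOn ℂ (fun s ↦ s - s * (s - 1) * mellin fractIoi (-s))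
      {s : ℂ | 0 < s.re} := by
    intro s hs
    have : DifferentiableAt ℂ (fun s ↦ mellin fractIoi (-s)) s :=
      (differentiableAt_mellin_fractIoi (by simpa using hs)).comp s
        differentiable_neg.differentiableAt
    exact DifferentiableAt.differentiableWithinAt (by fun_prop)
  refine AnalyticOnNhd.eqOn_of_preconnected_of_eventuallyEq (z₀ := 2)
    (differentiable_riemannZeta₁.differentiableOn.analyticOnNhd hU) (hd.analyticOnNhd hU)
    (convex_halfSpace_re_gt 0).isPreconnected (by simp) ?_ hs
  filter_upwards [(isOpen_lt continuous_const continuous_re).mem_nhds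
    (show (2 : ℂ) ∈ {s : ℂ | 1 < s.re} by simp)] with s hs using riemannZeta₁_eq_of_one_lt_re hs

theorem norm_riemannZeta₁_le {s : ℂ} (hs : 0 < s.re) :
    ‖riemannZeta₁ s‖ ≤ ‖s‖ + ‖s‖ * ‖s - 1‖ / s.re := by
  rw [riemannZeta₁_eq hs]
  refine (norm_sub_le _ _).trans ?_
  rw [norm_mul, norm_mul]
  gcongr
  rw [div_eq_mul_one_div]
  gcongr
  exact norm_mellin_fractIoi_neg_le hs

theorem riemannZeta₁_eq_mul {s : ℂ} (hs : s ≠ 1) : riemannZeta₁ s = (s - 1) * riemannZeta s := by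
  rw [riemannZeta_eq_inv_sub_mul hs, mul_inv_cancel_left₀ (sub_ne_zero.2 hs)]

theorem riemannZeta₁_ne_zero_of_one_le_re {s : ℂ} (hs : 1 ≤ s.re) : riemannZeta₁ s ≠ 0 := by
  rcases eq_or_ne s 1 with rfl | h
  · simp
  · rw [riemannZeta₁_eq_mul h]
    exact mul_ne_zero (sub_ne_zero.2 h) (riemannZeta_ne_zero_of_one_le_re hs)

open Complex in
theorem norm_riemannZeta_ofReal_le {σ : ℝ} (h1 : 1 < σ) (h3 : σ ≤ 3) :
    ‖riemannZeta σ‖ ≤ 5 / (σ - 1) := by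
  have hσ : (0 : ℝ) < σ - 1 := by linarith
  rw [riemannZeta_eq_inv_sub_mul (by exact_mod_cast h1.ne'), norm_mul, norm_inv]
  have h := norm_riemannZeta₁_le (s := σ) (by simp; linarith)
  have e : ‖(σ - 1 : ℂ)‖ = σ - 1 := by
    rw [← ofReal_one, ← ofReal_sub, norm_real, Real.norm_eq_abs, abs_of_pos hσ]
  rw [e, ofReal_re, norm_real, Real.norm_eq_abs, abs_of_pos (by linarith),
    mul_div_assoc, mul_div_cancel₀ _ (by linarith)] at h
  rw [e, div_eq_inv_mul]
  gcongr
  linarith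

open Complex in
/-- Comparison of a Dirichlet series with a majorant at the real part. -/
theorem norm_LSeries_le {f : ℕ → ℂ} {g : ℕ → ℝ} {s : ℂ} (hfg : ∀ n, ‖f n‖ ≤ g n)
    (hg : LSeriesSummable (fun n ↦ (g n : ℂ)) s.re) :
    ‖LSeries f s‖ ≤ ‖LSeries (fun n ↦ (g n : ℂ)) s.re‖ := by
  have h0 : ∀ n, 0 ≤ g n := fun n ↦ (norm_nonneg _).trans (hfg n)
  have hr : ∀ n, LSeries.term (fun n ↦ (g n : ℂ)) s.re n =
      ((if n = 0 then 0 else g n / (n : ℝ) ^ s.re : ℝ) : ℂ) := by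
    intro n
    rw [LSeries.term_def]
    split_ifs
    · simp
    · rw [ofReal_div, ofReal_cpow (Nat.cast_nonneg n), ofReal_natCast]
  have hs : Summable fun n : ℕ ↦ (if n = 0 then 0 else g n / (n : ℝ) ^ s.re : ℝ) := by
    rw [← summable_ofReal]
    exact hg.congr hr
  have h1 : ∀ n, ‖LSeries.term f s n‖ ≤ (if n = 0 then 0 else g n / (n : ℝ) ^ s.re : ℝ) := by
    intro n
    rw [LSeries.norm_term_eq]
    split_ifs
    · rfl
    · gcongr
      exact hfg n
  have h2 := tsum_of_norm_bounded hs.hasSum h1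
  rw [LSeries, LSeries, tsum_congr hr, ← ofReal_tsum, norm_real]
  exact h2.trans (le_abs_self _)

open Complex ArithmeticFunction in
theorem sq_div_le_norm_riemannZeta₁ {s : ℂ} (h1 : 1 < s.re) (h3 : s.re ≤ 3) :
    (s.re - 1) ^ 2 / 5 ≤ ‖riemannZeta₁ s‖ := by
  have hs1 : s ≠ 1 := by rintro rfl; simp at h1
  have hσ : (0 : ℝ) < s.re - 1 := by linarith
  have hμ := congrArg norm (LSeries_one_mul_Lseries_moebius h1)
  rw [LSeries_one_eq_riemannZeta h1, norm_mul, norm_one] at hμ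
  have hb : ‖LSeries (fun n ↦ (moebius n : ℂ)) s‖ ≤ 5 / (s.re - 1) := by
    refine le_trans ?_ (norm_riemannZeta_ofReal_le h1 h3)
    rw [← LSeries_one_eq_riemannZeta (by simpa using h1)]
    have := norm_LSeries_le (f := fun n ↦ (moebius n : ℂ)) (g := fun _ ↦ 1) (s := s) (fun n ↦ by
        rw [norm_intCast]
        exact_mod_cast abs_moebius_le_one) (by
        rw [ofReal_one]
        exact LSeriesSummable_one_iff.2 (show 1 < (s.re : ℂ).re by simpa using h1))
    rw [ofReal_one] at this
    exact this
  have h4 : s.re - 1 ≤ ‖s - 1‖ := by simpa using re_le_norm (s - 1)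
  rw [riemannZeta₁_eq_mul hs1, norm_mul]
  have h5 : 1 ≤ ‖riemannZeta s‖ * (5 / (s.re - 1)) := hμ.symm.le.trans (by gcongr)
  have h6 : (s.re - 1) / 5 ≤ ‖riemannZeta s‖ := by
    rw [mul_div_assoc', le_div_iff₀ hσ] at h5
    linarith
  calc (s.re - 1) ^ 2 / 5 = (s.re - 1) * ((s.re - 1) / 5) := by ring
    _ ≤ _ := by gcongr

open Complex ArithmeticFunction in
theorem LSeries_vonMangoldt_eq_inv_sub {s : ℂ} (hs : 1 < s.re) :
    LSeries (fun n ↦ (vonMangoldt n : ℂ)) s =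
      1 / (s - 1) - deriv riemannZeta₁ s / riemannZeta₁ s := by
  have hs1 : s ≠ 1 := by rintro rfl; simp at hs
  have h := sub_ne_zero.2 hs1
  have hz := riemannZeta₁_ne_zero_of_one_le_re hs.le
  rw [LSeries_vonMangoldt_eq_deriv_riemannZeta_div hs, riemannZeta_eq_inv_sub_mul hs1,
    deriv_riemannZeta_eq_neg_inv_sub_sq_mul_add hs1]
  field_simp
  ring

theorem continuousOn_logDeriv_riemannZeta₁ :
    ContinuousOn (fun s ↦ deriv riemannZeta₁ s / riemannZeta₁ s) {s | riemannZeta₁ s ≠ 0} :=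
  differentiable_riemannZeta₁.deriv.continuous.continuousOn.div
    differentiable_riemannZeta₁.continuous.continuousOn fun _ h ↦ h

open Complex ArithmeticFunction in
theorem exists_norm_LSeries_vonMangoldt_le : ∃ C > 0, ∀ s : ℂ, 1 < s.re → s.re ≤ 3 →
    ‖LSeries (fun n ↦ (vonMangoldt n : ℂ)) s‖ ≤ 1 / (s.re - 1) + C := by
  have hc : ContinuousOn (fun σ : ℝ ↦ deriv riemannZeta₁ σ / riemannZeta₁ σ) (Set.Icc 1 3) :=
    continuousOn_logDeriv_riemannZeta₁.comp continuous_ofReal.continuousOn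
      fun σ hσ ↦ riemannZeta₁_ne_zero_of_one_le_re (by simpa using hσ.1)
  obtain ⟨C, hC⟩ := isCompact_Icc.exists_bound_of_continuousOn hc
  refine ⟨|C| + 1, by positivity, fun s h1 h3 ↦ ?_⟩
  have h1' : 1 < (s.re : ℂ).re := by simpa using h1
  refine (norm_LSeries_le (g := fun n ↦ vonMangoldt n) (fun n ↦ ?_)
    (LSeriesSummable_vonMangoldt h1')).trans ?_
  · rw [norm_real, Real.norm_eq_abs, abs_of_nonneg vonMangoldt_nonneg]
  · rw [LSeries_vonMangoldt_eq_inv_sub h1']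
    refine (norm_sub_le _ _).trans ?_
    have e : ‖(1 : ℂ) / (s.re - 1)‖ = 1 / (s.re - 1) := by
      rw [← ofReal_one, ← ofReal_sub, ← ofReal_div, norm_real, Real.norm_eq_abs, abs_of_pos]
      exact one_div_pos.2 (by linarith)
    rw [e]
    have := hC s.re ⟨h1.le, h3⟩
    linarith [le_abs_self C]

open Complex ArithmeticFunction in
/-- The inequality resulting from `3 + 4 cos θ + cos 2θ ≥ 0`. -/
theorem three_four_one_LSeries_vonMangoldt {σ : ℝ} (hσ : 1 < σ) (t : ℝ) :
    0 ≤ (3 * LSeries (fun n ↦ (vonMangoldt n : ℂ)) σ +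
      4 * LSeries (fun n ↦ (vonMangoldt n : ℂ)) (σ + t * I) +
      LSeries (fun n ↦ (vonMangoldt n : ℂ)) (σ + 2 * t * I)).re := by
  have s0 := LSeriesSummable_vonMangoldt (s := σ) (by simpa using hσ)
  have s1 := LSeriesSummable_vonMangoldt (s := σ + t * I) (by simpa using hσ)
  have s2 := LSeriesSummable_vonMangoldt (s := σ + 2 * t * I) (by simpa using hσ)
  have h := ((s0.hasSum.mul_left 3).add (s1.hasSum.mul_left 4)).add s2.hasSum
  have h' := hasSum_re h
  rw [LSeries, LSeries, LSeries, ← h'.tsum_eq]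
  refine tsum_nonneg fun n ↦ ?_
  rcases eq_or_ne n 0 with rfl | hn
  · simp
  have key : ∀ y : ℝ, LSeries.term (fun n ↦ (vonMangoldt n : ℂ)) (σ + y * I) n =
      ((vonMangoldt n / (n : ℝ) ^ σ : ℝ) : ℂ) * exp ((-(y * Real.log n) : ℝ) * I) := by
    intro y
    have hn' : (n : ℂ) ≠ 0 := by exact_mod_cast hn
    rw [LSeries.term_of_ne_zero hn, cpow_add _ _ hn', ofReal_div,
      ofReal_cpow (Nat.cast_nonneg n), ofReal_natCast, div_mul_eq_div_div,
      div_eq_mul_inv _ (_ ^ (_ * I)), ← cpow_neg, cpow_def_of_ne_zero hn' (-_)]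
    congr 2
    push_cast
    rw [← natCast_log]
    ring
  have k0 := key 0
  have k2 := key (2 * t)
  simp only [ofReal_zero, zero_mul, add_zero, ofReal_mul, ofReal_ofNat] at k0 k2
  rw [k0, key t, k2]
  simp only [add_re, mul_re, re_ofNat, im_ofNat, exp_ofReal_mul_I_re, zero_mul, sub_zero,
    ofReal_re, ofReal_im, neg_zero, ofReal_zero, exp_zero, Real.cos_neg, mul_one]
  have hv : 0 ≤ vonMangoldt n / (n : ℝ) ^ σ := div_nonneg vonMangoldt_nonneg (by positivity)
  rw [mul_assoc 2 t, Real.cos_two_mul]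
  nlinarith [mul_nonneg hv (sq_nonneg (Real.cos (t * Real.log n) + 1))]

theorem one_le_log_abs_add_four (t : ℝ) : 1 ≤ Real.log (|t| + 4) := by
  rw [Real.le_log_iff_exp_le (by positivity)]
  linarith [Real.exp_one_lt_d9, abs_nonneg t]

open Complex in
theorem norm_riemannZeta₁_add_le {s z : ℂ} (h1 : 1 < s.re) (h3 : s.re ≤ 3 / 2)
    (hz : ‖z‖ ≤ 1 / 2) :
    ‖riemannZeta₁ (s + z)‖ ≤ ‖riemannZeta₁ s‖ *
      Real.exp (5 * (Real.log (|s.im| + 4) + 1 / √(s.re - 1))) := by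
  have hη : 0 < s.re - 1 := by linarith
  set η := s.re - 1 with hηd
  set T := |s.im| + 4 with hT
  have hT0 : 0 < T := by positivity
  have hzr := (abs_le.1 ((abs_re_le_norm z).trans hz)).1
  have hre : 1 / 2 ≤ (s + z).re := by rw [add_re]; linarith
  have hs : ‖s‖ ≤ 3 / 2 + |s.im| := by
    refine (norm_le_abs_re_add_abs_im s).trans ?_
    rw [abs_of_pos (by linarith)]
    linarith
  have hs1 : ‖s - 1‖ ≤ 1 / 2 + |s.im| := by
    refine (norm_le_abs_re_add_abs_im _).trans ?_
    rw [sub_re, sub_im, one_re, one_im, abs_of_pos hη, sub_zero]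
    linarith
  have hsz : ‖s + z‖ ≤ T := (norm_add_le _ _).trans (by linarith)
  have hsz1 : ‖s + z - 1‖ ≤ T - 1 := by
    rw [add_sub_right_comm]
    exact (norm_add_le _ _).trans (by linarith)
  have hT1 : 0 ≤ T - 1 := by linarith [abs_nonneg s.im]
  have hZ : ‖riemannZeta₁ (s + z)‖ ≤ 2 * T ^ 2 := by
    refine (norm_riemannZeta₁_le (by linarith)).trans ?_
    calc ‖s + z‖ + ‖s + z‖ * ‖s + z - 1‖ / (s + z).re
        ≤ T + T * (T - 1) / (1 / 2) := by gcongr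
      _ ≤ 2 * T ^ 2 := by nlinarith
  have hlow := sq_div_le_norm_riemannZeta₁ h1 (by linarith)
  have hexp : 10 * T ^ 2 / η ^ 2 ≤ Real.exp (5 * (Real.log T + 1 / √η)) := by
    have h10 : (10 : ℝ) ≤ Real.exp (3 * Real.log T) := by
      have : (4 : ℝ) ≤ T := by linarith [abs_nonneg s.im]
      rw [mul_comm, Real.exp_mul, Real.exp_log hT0]
      norm_cast
      nlinarith [pow_le_pow_left₀ (by norm_num) this 3]
    have hT2 : T ^ 2 = Real.exp (2 * Real.log T) := by
      rw [mul_comm, Real.exp_mul, Real.exp_log hT0]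
      norm_cast
    have hη2 : 1 / η ^ 2 ≤ Real.exp (5 * (1 / √η)) := by
      have hq : 0 < √η := Real.sqrt_pos.2 hη
      have : 1 / √η ≤ Real.exp (1 / √η) := by linarith [Real.add_one_le_exp (1 / √η)]
      calc 1 / η ^ 2 = (1 / √η) ^ 4 := by
            nth_rw 1 [← Real.sq_sqrt hη.le]; field_simp
        _ ≤ Real.exp (1 / √η) ^ 4 := by gcongr
        _ = Real.exp (4 * (1 / √η)) := by rw [← Real.exp_nat_mul]; norm_num
        _ ≤ _ := Real.exp_le_exp.2 (by gcongr; norm_num)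
    calc 10 * T ^ 2 / η ^ 2 = 10 * T ^ 2 * (1 / η ^ 2) := by ring
      _ ≤ Real.exp (3 * Real.log T) * Real.exp (2 * Real.log T) * Real.exp (5 * (1 / √η)) := by
        rw [← hT2]; gcongr
      _ = _ := by rw [← Real.exp_add, ← Real.exp_add]; ring_nf
  calc ‖riemannZeta₁ (s + z)‖ ≤ 2 * T ^ 2 := hZ
    _ = η ^ 2 / 5 * (10 * T ^ 2 / η ^ 2) := by field_simp; norm_num
    _ ≤ _ := by gcongr

open Complex Metric in
theorem neg_le_re_logDeriv_riemannZeta₁ {s : ℂ} (h1 : 1 < s.re) (h3 : s.re ≤ 3 / 2) :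
    -(80 * (Real.log (|s.im| + 4) + 1 / √(s.re - 1))) ≤
      (deriv riemannZeta₁ s / riemannZeta₁ s).re := by
  have hL := one_le_log_abs_add_four s.im
  have := neg_le_re_logDeriv (f := fun z ↦ riemannZeta₁ (s + z)) (r := 1 / 4) (R := 1 / 2)
    (A := 5 * (Real.log (|s.im| + 4) + 1 / √(s.re - 1))) (by norm_num) (by norm_num)
    (by positivity)
    (differentiable_riemannZeta₁.comp (differentiable_id.const_add s)).diffContOnCl
    (fun z hz ↦ norm_riemannZeta₁_add_le h1 h3 (mem_sphere_zero_iff_norm.1 hz).le)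
    (by simp) (by simpa using riemannZeta₁_ne_zero_of_one_le_re h1.le)
    (fun z hz h ↦ by
      by_contra! hzr
      exact riemannZeta₁_ne_zero_of_one_le_re (by rw [add_re]; linarith) h)
  rw [deriv_comp_const_add, add_zero] at this
  linarith

open Complex Metric in
theorem neg_add_le_re_logDeriv_riemannZeta₁ {s : ℂ} (h1 : 1 < s.re) (h3 : s.re ≤ 3 / 2)
    {w : ℝ} (hw : 0 < w) (hw2 : w < 1 / 2) (hzero : riemannZeta₁ (s - w) = 0) :
    1 / w - 4 * w - 80 * (Real.log (|s.im| + 4) + 1 / √(s.re - 1)) ≤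
      (deriv riemannZeta₁ s / riemannZeta₁ s).re := by
  have hL := one_le_log_abs_add_four s.im
  have := neg_add_le_re_logDeriv_of_zero (f := fun z ↦ riemannZeta₁ (s + z)) (r := 1 / 4)
    (R := 1 / 2) (A := 5 * (Real.log (|s.im| + 4) + 1 / √(s.re - 1))) (by norm_num) (by norm_num)
    (by positivity)
    (differentiable_riemannZeta₁.comp (differentiable_id.const_add s)).diffContOnCl
    (fun z hz ↦ norm_riemannZeta₁_add_le h1 h3 (mem_sphere_zero_iff_norm.1 hz).le)
    (by simp) (by simpa using riemannZeta₁_ne_zero_of_one_le_re h1.le)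
    (fun z hz h ↦ by
      by_contra! hzr
      exact riemannZeta₁_ne_zero_of_one_le_re (by rw [add_re]; linarith) h)
    hw hw2 (by rwa [← sub_eq_add_neg])
  rw [deriv_comp_const_add, add_zero, show w / (1 / 2) ^ 2 = 4 * w by ring] at this
  linarith

open Complex in
theorem re_one_div_le_one {s : ℂ} (h : 1 ≤ |s.im|) : (1 / (s - 1)).re ≤ 1 := by
  refine (re_le_norm _).trans ?_
  rw [norm_div, norm_one]
  have : 1 ≤ ‖s - 1‖ := h.trans (by simpa using abs_im_le_norm (s - 1))
  exact div_le_one_of_le₀ this (norm_nonneg _)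

open Complex in
/-- The classical zero-free region away from the real axis, in terms of an auxiliary abscissa
`1 + η`. -/
theorem exists_one_le_of_riemannZeta₁_eq_zero : ∃ K > 0, ∀ (s : ℂ) (η : ℝ), 0 < η → η ≤ 1 / 4 →
    1 ≤ |s.im| → 1 - η / 4 ≤ s.re → riemannZeta₁ s = 0 →
    1 ≤ K * (η * Real.log (|s.im| + 4) + √η) := by
  obtain ⟨C, hC0, hC⟩ := exists_norm_LSeries_vonMangoldt_le
  refine ⟨5 * (3 * C + 900), by positivity, fun s η hη hη4 him hre hzero ↦ ?_⟩
  have hre1 : s.re < 1 := by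
    by_contra! h
    exact riemannZeta₁_ne_zero_of_one_le_re h hzero
  set t := s.im with ht
  set L := Real.log (|t| + 4)
  have hL : 1 ≤ L := one_le_log_abs_add_four t
  set w := 1 + η - s.re with hw
  have hq : 0 < √η := Real.sqrt_pos.2 hη
  have h341 := three_four_one_LSeries_vonMangoldt (σ := 1 + η) (by linarith) t
  have e1 : ((1 + η : ℝ) + t * I : ℂ).re = 1 + η := by simp
  have e2 : ((1 + η : ℝ) + t * I : ℂ).im = t := by simp
  have e3 : ((1 + η : ℝ) + 2 * t * I : ℂ).re = 1 + η := by simp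
  have e4 : ((1 + η : ℝ) + 2 * t * I : ℂ).im = 2 * t := by simp
  have h0 := (re_le_norm _).trans (hC (1 + η : ℝ) (by simpa using hη) (by simp; linarith))
  have h1 := neg_add_le_re_logDeriv_riemannZeta₁ (s := (1 + η : ℝ) + t * I) (w := w)
    (by linarith) (by linarith) (by linarith) (by linarith) (by
      convert hzero using 2
      apply Complex.ext
      · rw [sub_re, e1, ofReal_re]; linarith
      · rw [sub_im, e2, ofReal_im, sub_zero])
  have h2 := neg_le_re_logDeriv_riemannZeta₁ (s := (1 + η : ℝ) + 2 * t * I)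
    (by linarith) (by linarith)
  have h3 := re_one_div_le_one (s := (1 + η : ℝ) + t * I) (by rwa [e2])
  have h4 := re_one_div_le_one (s := (1 + η : ℝ) + 2 * t * I) (by
    rw [e4, abs_mul, abs_two]; linarith)
  rw [add_re, add_re, LSeries_vonMangoldt_eq_inv_sub (s := _ + t * I) (by linarith),
    LSeries_vonMangoldt_eq_inv_sub (s := _ + 2 * t * I) (by linarith)] at h341
  simp only [mul_re, re_ofNat, im_ofNat, zero_mul, sub_zero, sub_re] at h341
  rw [e1, e2] at h1
  rw [e3, e4] at h2
  rw [ofReal_re] at h0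
  have hL2 : Real.log (|2 * t| + 4) ≤ 2 * L := by
    rw [← Real.log_rpow (by positivity), Real.rpow_ofNat]
    refine Real.log_le_log (by positivity) ?_
    rw [abs_mul, abs_two]
    nlinarith [abs_nonneg t]
  have hw4 : 3 / η + 1 / (5 * η) ≤ 4 * (1 / w) := by
    have : w ≤ 5 / 4 * η := by linarith
    calc 3 / η + 1 / (5 * η) = 4 * (1 / (5 / 4 * η)) := by field_simp; norm_num
      _ ≤ _ := by gcongr; linarith
  rw [show 1 + η - 1 = η by ring] at h0 h1 h2
  have hmain : 1 / (5 * η) ≤ (3 * C + 900) * (L + 1 / √η) := by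
    have e : 3 * (1 / η) = 3 / η := by ring
    have : 0 < 1 / √η := by positivity
    nlinarith
  have := mul_le_mul_of_nonneg_left hmain (show 0 ≤ 5 * η by positivity)
  rw [mul_one_div_cancel (by positivity)] at this
  calc 1 ≤ _ := this
    _ = 5 * (3 * C + 900) * (η * L + η / √η) := by ring
    _ = _ := by rw [Real.div_sqrt]

open Complex Metric in
theorem exists_riemannZeta₁_ne_zero : ∃ c > 0, c ≤ 1 / 4 ∧ ∀ s : ℂ,
    1 - c / Real.log (|s.im| + 4) ≤ s.re → riemannZeta₁ s ≠ 0 := by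
  obtain ⟨K, hK0, hK⟩ := exists_one_le_of_riemannZeta₁_eq_zero
  have hcpt : IsCompact ((fun t : ℝ ↦ (1 + t * I : ℂ)) '' Set.Icc (-1) 1) :=
    isCompact_Icc.image (by fun_prop)
  obtain ⟨δ, hδ0, hδ⟩ := hcpt.exists_cthickening_subset_open
    (isOpen_ne_fun differentiable_riemannZeta₁.continuous continuous_const)
    (fun s ⟨t, _, ht⟩ ↦ riemannZeta₁_ne_zero_of_one_le_re (by simp [← ht]))
  obtain ⟨q, hq0, hq4, hqK⟩ : ∃ q > 0, q ≤ 1 / 2 ∧ K * (2 * q) < 1 := by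
    refine ⟨min (1 / 2) (1 / (4 * K)), by positivity, min_le_left _ _, ?_⟩
    calc K * (2 * min (1 / 2) (1 / (4 * K))) ≤ K * (2 * (1 / (4 * K))) := by
          gcongr; exact min_le_right _ _
      _ < 1 := by field_simp; norm_num
  refine ⟨min (q ^ 2 / 4) δ, by positivity, (min_le_left _ _).trans (by nlinarith),
    fun s hs hzero ↦ ?_⟩
  have hL := one_le_log_abs_add_four s.im
  set L := Real.log (|s.im| + 4)
  have hre1 : s.re < 1 := by
    by_contra! h
    exact riemannZeta₁_ne_zero_of_one_le_re h hzero
  rcases le_total 1 |s.im| with him | him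
  · have hle : q ^ 2 / L ≤ q ^ 2 := div_le_self (by positivity) hL
    have := hK s (q ^ 2 / L) (by positivity) (hle.trans (by nlinarith)) him (by
      refine le_trans ?_ hs
      rw [div_right_comm]
      gcongr
      exact min_le_left _ _) hzero
    rw [div_mul_cancel₀ _ (by positivity)] at this
    have h2 : √(q ^ 2 / L) ≤ q := by
      rw [Real.sqrt_le_left hq0.le]; exact hle
    have h3 : q ^ 2 ≤ q := by nlinarith
    have : K * (q ^ 2 + √(q ^ 2 / L)) ≤ K * (2 * q) := by gcongr; linarith
    linarith
  · refine hδ ?_ hzero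
    refine mem_cthickening_of_dist_le _ (1 + s.im * I) _ _ ⟨s.im, abs_le.1 him, rfl⟩ ?_
    have h2 : min (q ^ 2 / 4) δ / L ≤ δ :=
      (div_le_self (by positivity) hL).trans (min_le_right _ _)
    have h3 : s - (1 + s.im * I) = ((s.re - 1 : ℝ) : ℂ) := by
      apply Complex.ext <;> simp
    rw [dist_eq_norm, h3, norm_real, Real.norm_eq_abs, abs_le]
    constructor <;> linarith

theorem log_abs_add_four_le_two_mul {t u : ℝ} (h : |u - t| ≤ 1) :
    Real.log (|u| + 4) ≤ 2 * Real.log (|t| + 4) := by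
  rw [← Real.log_rpow (by positivity), Real.rpow_ofNat]
  refine Real.log_le_log (by positivity) ?_
  have : |u| ≤ |u - t| + |t| := by simpa using abs_add_le (u - t) t
  nlinarith [abs_nonneg t]

open Complex Metric in
/-- The logarithmic derivative of `(s - 1) ζ(s)` in a zero-free region. -/
theorem exists_norm_logDeriv_riemannZeta₁_le : ∃ c > 0, c ≤ 1 / 4 ∧ ∃ C > 0, ∀ s : ℂ,
    1 - c / Real.log (|s.im| + 4) ≤ s.re → s.re ≤ 2 → riemannZeta₁ s ≠ 0 ∧
      ‖deriv riemannZeta₁ s / riemannZeta₁ s‖ ≤ C * Real.log (|s.im| + 4) ^ 2 := by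
  obtain ⟨c, hc0, hc4, hc⟩ := exists_riemannZeta₁_ne_zero
  obtain ⟨C, hC0, hC⟩ := exists_norm_LSeries_vonMangoldt_le
  refine ⟨c / 4, by positivity, by linarith, 560 / c * (1 + 2 / c) + (4 / c + C), by positivity,
    fun s hs hs2 ↦ ?_⟩
  have hL := one_le_log_abs_add_four s.im
  set L := Real.log (|s.im| + 4) with hLd
  set η := c / (2 * L) with hηd
  have hη : 0 < η := by positivity
  have hη8 : η ≤ 1 / 8 := by
    rw [hηd, div_le_iff₀ (by positivity)]; linarith
  have hηL : 1 / η = 2 * L / c := by rw [hηd, one_div_div]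
  have hLL : L ≤ L ^ 2 := by nlinarith
  rw [div_div, show c / (4 * L) = η / 2 by rw [hηd]; ring] at hs
  refine ⟨hc s (le_trans ?_ hs), ?_⟩
  · rw [show c / L = 2 * η by rw [hηd]; field_simp]; linarith
  rcases le_total s.re (1 + η) with h | h
  · set s₀ : ℂ := (1 + η : ℝ) + s.im * I with hs₀
    have e1 : s₀.re = 1 + η := by simp [hs₀]
    have e2 : s₀.im = s.im := by simp [hs₀]
    have hz : s - s₀ = ((s.re - (1 + η) : ℝ) : ℂ) := by
      apply Complex.ext
      · rw [sub_re, e1, ofReal_re]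
      · rw [sub_im, e2, ofReal_im, sub_self]
    have hA := norm_logDeriv_le_of_norm_le (f := fun z ↦ riemannZeta₁ (s₀ + z)) (r := 2 * η)
      (A := 5 * (Real.log (|s₀.im| + 4) + 1 / √(s₀.re - 1))) (ρ := 3 * η / 2) (δ := η / 4)
      (z := s - s₀) (by rw [e2]; positivity) (by positivity) (by positivity) (by linarith)
      (differentiable_riemannZeta₁.comp (differentiable_id.const_add s₀)).differentiableOn
      (fun z hz ↦ ?_) (fun z hz ↦ ?_) ?_
    · rw [deriv_comp_const_add, add_sub_cancel, e1, e2, ← hLd, add_sub_cancel_left] at hA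
      refine hA.trans ?_
      have e3 : 2 * (5 * (L + 1 / √η)) * (3 * η / 2 + η / 4) /
          (2 * η - (3 * η / 2 + η / 4)) / (η / 4) = 280 * (L + 1 / √η) * (1 / η) := by
        rw [show 2 * η - (3 * η / 2 + η / 4) = η / 4 by ring]
        field_simp
        norm_num
      have e4 : 1 / √η ≤ 2 * L / c := by
        rw [← hηL]
        gcongr
        exact Real.le_sqrt_of_sq_le (by nlinarith)
      rw [e3, hηL]
      calc 280 * (L + 1 / √η) * (2 * L / c) ≤ 280 * (L + 2 * L / c) * (2 * L / c) := by gcongr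
        _ = 560 / c * (1 + 2 / c) * L ^ 2 := by ring
        _ ≤ _ := by gcongr; exact le_add_of_nonneg_right (by positivity)
    · rw [mem_ball_zero_iff] at hz
      have hre := (abs_le.1 (abs_re_le_norm z)).1
      have him := abs_im_le_norm z
      refine hc _ ?_
      have h5 : Real.log (|(s₀ + z).im| + 4) ≤ 2 * L :=
        log_abs_add_four_le_two_mul (by
          rw [add_im, e2, add_sub_cancel_left]; linarith)
      have h6 : η ≤ c / Real.log (|(s₀ + z).im| + 4) := by
        rw [hηd]
        have := one_le_log_abs_add_four (s₀ + z).im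
        gcongr
      rw [add_re, e1]
      linarith
    · rw [mem_ball_zero_iff] at hz
      simpa only [add_zero] using norm_riemannZeta₁_add_le (by linarith) (by linarith)
        (by linarith)
    · rw [hz, norm_real, Real.norm_eq_abs, abs_le]
      constructor <;> linarith
  · have h1 : 1 < s.re := by linarith
    have e : deriv riemannZeta₁ s / riemannZeta₁ s =
        1 / (s - 1) - LSeries (fun n ↦ (ArithmeticFunction.vonMangoldt n : ℂ)) s := by
      rw [LSeries_vonMangoldt_eq_inv_sub h1, sub_sub_cancel]
    have h2 := hC s h1 (by linarith)
    have h3 : ‖1 / (s - 1)‖ ≤ 1 / (s.re - 1) := by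
      rw [norm_div, norm_one]
      have : s.re - 1 ≤ ‖s - 1‖ := by simpa using re_le_norm (s - 1)
      have : 0 < s.re - 1 := by linarith
      gcongr
    have h4 : 1 / (s.re - 1) ≤ 1 / η := by gcongr; linarith
    rw [hηL] at h4
    rw [e]
    calc _ ≤ _ := norm_sub_le _ _
      _ ≤ 2 * L / c + (2 * L / c + C) := by linarith
      _ = 4 / c * L + C * 1 := by ring
      _ ≤ 4 / c * L ^ 2 + C * L ^ 2 := by gcongr; linarith
      _ = (4 / c + C) * L ^ 2 := by ring
      _ ≤ _ := by
        refine mul_le_mul_of_nonneg_right ?_ (by positivity)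
        have : 0 ≤ 560 / c * (1 + 2 / c) := by positivity
        linarith

open Complex in
theorem norm_inv_mul_add_one_le {s : ℂ} (hs : 1 / 2 ≤ s.re) :
    ‖1 / (s * (s + 1))‖ ≤ 4 * (1 + s.im ^ 2)⁻¹ := by
  have h1 : (1 + s.im ^ 2) / 4 ≤ ‖s‖ ^ 2 := by
    rw [← normSq_eq_norm_sq, normSq_apply]; nlinarith [sq_nonneg s.im]
  have h2 : ‖s‖ ^ 2 ≤ ‖s + 1‖ ^ 2 := by
    rw [← normSq_eq_norm_sq, ← normSq_eq_norm_sq, normSq_apply, normSq_apply, add_re, add_im,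
      one_re, one_im]
    nlinarith
  have h3 : ‖s‖ ≤ ‖s + 1‖ := (sq_le_sq₀ (norm_nonneg _) (norm_nonneg _)).1 h2
  have h0 : 0 < ‖s‖ := lt_of_lt_of_le (by linarith) (re_le_norm s)
  rw [norm_div, norm_one, norm_mul, ← div_eq_mul_inv,
    div_le_div_iff₀ (mul_pos h0 (h0.trans_le h3)) (by positivity)]
  nlinarith [norm_nonneg s]

/-- The Fejér-type weight `(1 - u)₊` on the positive reals. -/
noncomputable def tentWeight (u : ℝ) : ℂ :=
  (Set.Ioc (0 : ℝ) 1).indicator (fun u : ℝ ↦ (1 - u : ℂ)) u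

/-- The weight whose Mellin transform is `1 / ((s - 1) * s * (s + 1))`. -/
noncomputable def poleWeight (u : ℝ) : ℂ :=
  (Set.Ioc (0 : ℝ) 1).indicator (fun u : ℝ ↦ ((1 - u) ^ 2 / (2 * u) : ℂ)) u

theorem tentWeight_of_le_one {u : ℝ} (h0 : 0 < u) (h : u ≤ 1) : tentWeight u = 1 - u :=
  Set.indicator_of_mem (Set.mem_Ioc.2 ⟨h0, h⟩) _

theorem tentWeight_of_one_le {u : ℝ} (h : 1 ≤ u) : tentWeight u = 0 := by
  rcases h.eq_or_lt with rfl | h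
  · simp [tentWeight_of_le_one]
  · exact Set.indicator_of_notMem (by simp [h]) _

theorem poleWeight_of_le_one {u : ℝ} (h0 : 0 < u) (h : u ≤ 1) :
    poleWeight u = (1 - u) ^ 2 / (2 * u) :=
  Set.indicator_of_mem (Set.mem_Ioc.2 ⟨h0, h⟩) _

theorem poleWeight_of_one_le {u : ℝ} (h : 1 ≤ u) : poleWeight u = 0 := by
  rcases h.eq_or_lt with rfl | h
  · simp [poleWeight_of_le_one]
  · exact Set.indicator_of_notMem (by simp [h]) _

open Complex Set in
theorem hasMellin_tentWeight {s : ℂ} (hs : 0 < s.re) :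
    HasMellin tentWeight s (1 / (s * (s + 1))) := by
  have h1 := hasMellin_one_Ioc hs
  have h2 := hasMellin_cpow_Ioc 1 (s := s) (by rw [one_re]; linarith)
  have h := hasMellin_sub h1.1 h2.1
  rw [h1.2, h2.2] at h
  have hs0 : s ≠ 0 := by rintro rfl; simp at hs
  have hs1 : s + 1 ≠ 0 := fun h ↦ by
    have := congrArg re h; simp at this; linarith
  have hf : tentWeight = fun t ↦ (Ioc (0 : ℝ) 1).indicator (fun _ ↦ (1 : ℂ)) t -
      (Ioc (0 : ℝ) 1).indicator (fun t : ℝ ↦ (t : ℂ) ^ (1 : ℂ)) t := by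
    funext u
    simp only [tentWeight, indicator_apply, cpow_one]
    split_ifs <;> simp
  have hv : 1 / (s * (s + 1)) = 1 / s - 1 / (s + 1) := by field_simp; ring
  rw [hf, hv]
  exact h

open Complex Set in
theorem hasMellin_poleWeight {s : ℂ} (hs : 1 < s.re) :
    HasMellin poleWeight s (1 / (s - 1) * (1 / (s * (s + 1)))) := by
  have h1 := hasMellin_one_Ioc (s := s) (by linarith)
  have h2 := hasMellin_cpow_Ioc 1 (s := s) (by rw [one_re]; linarith)
  have h3 := hasMellin_cpow_Ioc (-1) (s := s) (by rw [neg_re, one_re]; linarith)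
  have h2' := hasMellin_const_smul h2.1 (2⁻¹ : ℂ)
  have h3' := hasMellin_const_smul h3.1 (2⁻¹ : ℂ)
  have h4 := hasMellin_sub h3'.1 h1.1
  have h := hasMellin_add h4.1 h2'.1
  rw [h4.2, h3'.2, h2'.2, h1.2, h2.2, h3.2] at h
  have hs0 : s ≠ 0 := by rintro rfl; simp at hs; linarith
  have hs1 : s + 1 ≠ 0 := fun h ↦ by
    have := congrArg re h; simp at this; linarith
  have hs2 : s - 1 ≠ 0 := fun h ↦ by
    have := congrArg re h; simp at this; linarith
  have hf : poleWeight = fun t ↦ (2⁻¹ : ℂ) •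
      (Ioc (0 : ℝ) 1).indicator (fun t : ℝ ↦ (t : ℂ) ^ (-1 : ℂ)) t -
      (Ioc (0 : ℝ) 1).indicator (fun _ ↦ (1 : ℂ)) t +
      (2⁻¹ : ℂ) • (Ioc (0 : ℝ) 1).indicator (fun t : ℝ ↦ (t : ℂ) ^ (1 : ℂ)) t := by
    funext u
    simp only [poleWeight, indicator_apply, cpow_one]
    split_ifs with hu
    · have : (u : ℂ) ≠ 0 := by exact_mod_cast hu.1.ne'
      rw [cpow_neg_one]
      simp only [smul_eq_mul]
      field_simp
      ring
    · simp
  have hv : 1 / (s - 1) * (1 / (s * (s + 1))) =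
      (2⁻¹ : ℂ) • (1 / (s + -1)) - 1 / s + (2⁻¹ : ℂ) • (1 / (s + 1)) := by
    rw [← sub_eq_add_neg]
    simp only [smul_eq_mul]
    field_simp
    ring
  rw [hf, hv]
  exact h

open Complex Set Filter Topology in
theorem continuousAt_tentWeight {u : ℝ} (hu : 0 < u) : ContinuousAt tentWeight u := by
  have h : ContinuousAt (fun u : ℝ ↦ ((max (1 - u) 0 : ℝ) : ℂ)) u := by fun_prop
  refine h.congr ?_
  filter_upwards [Ioi_mem_nhds hu] with v hv
  rcases le_total v 1 with h1 | h1
  · rw [tentWeight_of_le_one hv h1, max_eq_left (by linarith)]; simp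
  · rw [tentWeight_of_one_le h1, max_eq_right (by linarith)]; simp

open Complex Set Filter Topology in
theorem continuousAt_poleWeight {u : ℝ} (hu : 0 < u) : ContinuousAt poleWeight u := by
  have h : ContinuousAt (fun u : ℝ ↦ ((max (1 - u) 0 ^ 2 / (2 * u) : ℝ) : ℂ)) u := by
    have : ContinuousAt (fun u : ℝ ↦ max (1 - u) 0 ^ 2 / (2 * u)) u :=
      ContinuousAt.div (by fun_prop) (by fun_prop) (by positivity)
    exact continuous_ofReal.continuousAt.comp this
  refine h.congr ?_
  filter_upwards [Ioi_mem_nhds hu] with v hv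
  rcases le_total v 1 with h1 | h1
  · rw [poleWeight_of_le_one hv h1, max_eq_left (by linarith)]; simp
  · rw [poleWeight_of_one_le h1, max_eq_right (by linarith)]; simp

open Complex MeasureTheory in
theorem integrable_inv_mul_add_one {σ : ℝ} (hσ : 1 / 2 ≤ σ) :
    Integrable fun y : ℝ ↦ 1 / ((σ + y * I : ℂ) * (σ + y * I + 1)) := by
  refine (integrable_inv_one_add_sq.const_mul 4).mono' ?_ (ae_of_all _ fun y ↦ ?_)
  · exact (Measurable.aestronglyMeasurable (by fun_prop))
  · simpa using norm_inv_mul_add_one_le (s := σ + y * I) (by simpa using hσ)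

open Complex MeasureTheory in
theorem tentWeight_eq_integral {σ u : ℝ} (hσ : 1 / 2 ≤ σ) (hu : 0 < u) :
    tentWeight u = (1 / (2 * Real.pi) : ℝ) •
      ∫ y : ℝ, (u : ℂ) ^ (-(σ + y * I : ℂ)) * (1 / ((σ + y * I : ℂ) * (σ + y * I + 1))) := by
  have hm : ∀ y : ℝ, mellin tentWeight (σ + y * I) =
      1 / ((σ + y * I : ℂ) * (σ + y * I + 1)) := fun y ↦
    (hasMellin_tentWeight (s := σ + y * I) (by simp; linarith)).2
  have := mellinInv_mellin_eq σ tentWeight hu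
    (hasMellin_tentWeight (s := σ) (by simp; linarith)).1
    (by simpa only [VerticalIntegrable, hm] using integrable_inv_mul_add_one hσ)
    (continuousAt_tentWeight hu)
  rw [← this, mellinInv]
  simp only [hm, smul_eq_mul]

open Complex MeasureTheory in
theorem integrable_inv_sub_mul {σ : ℝ} (hσ : 1 < σ) :
    Integrable fun y : ℝ ↦ 1 / (σ + y * I - 1) * (1 / ((σ + y * I : ℂ) * (σ + y * I + 1))) := by
  refine (integrable_inv_mul_add_one (by linarith)).bdd_mul (c := 1 / (σ - 1)) ?_
    (ae_of_all _ fun y ↦ ?_)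
  · exact (Measurable.aestronglyMeasurable (by fun_prop))
  · rw [norm_div, norm_one]
    have : σ - 1 ≤ ‖(σ + y * I - 1 : ℂ)‖ := by simpa using re_le_norm (σ + y * I - 1 : ℂ)
    have : 0 < σ - 1 := by linarith
    gcongr

open Complex MeasureTheory in
theorem poleWeight_eq_integral {σ u : ℝ} (hσ : 1 < σ) (hu : 0 < u) :
    poleWeight u = (1 / (2 * Real.pi) : ℝ) • ∫ y : ℝ, (u : ℂ) ^ (-(σ + y * I : ℂ)) *
      (1 / (σ + y * I - 1) * (1 / ((σ + y * I : ℂ) * (σ + y * I + 1)))) := by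
  have hm : ∀ y : ℝ, mellin poleWeight (σ + y * I) =
      1 / (σ + y * I - 1) * (1 / ((σ + y * I : ℂ) * (σ + y * I + 1))) := fun y ↦
    (hasMellin_poleWeight (s := σ + y * I) (by simpa using hσ)).2
  have := mellinInv_mellin_eq σ poleWeight hu
    (hasMellin_poleWeight (s := σ) (by simpa using hσ)).1
    (by simpa only [VerticalIntegrable, hm] using integrable_inv_sub_mul hσ)
    (continuousAt_poleWeight hu)
  rw [← this, mellinInv]
  simp only [hm, smul_eq_mul]

open Complex MeasureTheory in
theorem integrable_cpow_mul_inv {σ x : ℝ} (hσ : 1 / 2 ≤ σ) (hx : 0 < x) :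
    Integrable fun y : ℝ ↦ (x : ℂ) ^ (σ + y * I : ℂ) *
      (1 / ((σ + y * I : ℂ) * (σ + y * I + 1))) := by
  refine (integrable_inv_mul_add_one hσ).bdd_mul (c := x ^ σ) ?_ (ae_of_all _ fun y ↦ ?_)
  · exact (Continuous.const_cpow (by fun_prop)
      (Or.inl (ofReal_ne_zero.2 hx.ne'))).aestronglyMeasurable
  · simp [norm_cpow_eq_rpow_re_of_pos hx]

open Complex ArithmeticFunction MeasureTheory in
theorem vonMangoldt_mul_tentWeight_eq_integral {σ x : ℝ} (hσ : 1 / 2 ≤ σ) (hx : 0 < x) (n : ℕ) :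
    (vonMangoldt n : ℂ) * tentWeight (n / x) = (1 / (2 * Real.pi) : ℝ) •
      ∫ y : ℝ, LSeries.term (fun n ↦ (vonMangoldt n : ℂ)) (σ + y * I) n *
        ((x : ℂ) ^ (σ + y * I : ℂ) * (1 / ((σ + y * I : ℂ) * (σ + y * I + 1)))) := by
  rcases eq_or_ne n 0 with rfl | hn
  · simp
  have hn' : (0 : ℝ) < n := by positivity
  rw [tentWeight_eq_integral hσ (div_pos hn' hx), mul_smul_comm, ← integral_const_mul]
  congr 2
  funext y
  rw [LSeries.term_of_ne_zero hn, ofReal_div, ← ofReal_div,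
    div_eq_mul_inv (n : ℝ), ofReal_mul, mul_cpow_ofReal_nonneg hn'.le (by positivity),
    cpow_neg, cpow_neg, ofReal_inv, inv_cpow _ _ (by
      rw [arg_ofReal_of_nonneg hx.le]; exact Real.pi_pos.ne), inv_inv, ofReal_natCast]
  ring

open Complex ArithmeticFunction MeasureTheory in
theorem sum_vonMangoldt_tent_eq_integral {σ x : ℝ} (hσ : 1 < σ) (hx : 0 < x) :
    ((∑ n ∈ Ioc 0 ⌊x⌋₊, vonMangoldt n * (1 - n / x) : ℝ) : ℂ) = (1 / (2 * Real.pi) : ℝ) •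
      ∫ y : ℝ, LSeries (fun n ↦ (vonMangoldt n : ℂ)) (σ + y * I) *
        ((x : ℂ) ^ (σ + y * I : ℂ) * (1 / ((σ + y * I : ℂ) * (σ + y * I + 1)))) := by
  have hK := integrable_cpow_mul_inv (σ := σ) (by linarith) hx
  set K : ℝ → ℂ := fun y ↦ (x : ℂ) ^ (σ + y * I : ℂ) *
      (1 / ((σ + y * I : ℂ) * (σ + y * I + 1))) with hKdef
  have hnorm : ∀ (n : ℕ) (y : ℝ),
      ‖LSeries.term (fun n ↦ (vonMangoldt n : ℂ)) (σ + y * I) n‖ =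
        ‖LSeries.term (fun n ↦ (vonMangoldt n : ℂ)) σ n‖ := fun n y ↦ by
    simp [LSeries.norm_term_eq]
  have hsum : Summable fun n : ℕ ↦ ‖LSeries.term (fun n ↦ (vonMangoldt n : ℂ)) σ n‖ :=
    (LSeriesSummable_vonMangoldt (s := σ) (by simpa using hσ)).norm
  have hcont : ∀ n : ℕ, Continuous fun y : ℝ ↦
      LSeries.term (fun n ↦ (vonMangoldt n : ℂ)) (σ + y * I) n := fun n ↦ by
    rcases eq_or_ne n 0 with rfl | hn
    · simpa using continuous_const
    · have hn' : (n : ℂ) ≠ 0 := Nat.cast_ne_zero.2 hn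
      simp only [LSeries.term_of_ne_zero hn]
      exact continuous_const.div (Continuous.const_cpow (by fun_prop) (Or.inl hn'))
        fun y h ↦ hn' ((cpow_eq_zero_iff _ _).1 h).1
  have h := hasSum_integral_of_summable_integral_norm (μ := volume)
    (F := fun n (y : ℝ) ↦ LSeries.term (fun n ↦ (vonMangoldt n : ℂ)) (σ + y * I) n * K y)
    (fun n ↦ hK.bdd_mul (hcont n).aestronglyMeasurable (ae_of_all _ fun y ↦ (hnorm n y).le))
    (by simpa only [norm_mul, hnorm, integral_const_mul] using hsum.mul_right _)
  simp only [tsum_mul_right] at h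
  have h2 := h.const_smul (1 / (2 * Real.pi) : ℝ)
  simp only [hKdef, ← vonMangoldt_mul_tentWeight_eq_integral (by linarith : 1 / 2 ≤ σ) hx] at h2
  refine HasSum.unique (f := fun n : ℕ ↦ (vonMangoldt n : ℂ) * tentWeight (n / x)) ?_ h2
  rw [ofReal_sum]
  convert hasSum_sum_of_ne_finset_zero (L := .unconditional ℕ) (s := Ioc 0 ⌊x⌋₊) ?_ using 1
  · refine sum_congr rfl fun n hn ↦ ?_
    rw [mem_Ioc] at hn
    rw [tentWeight_of_le_one (div_pos (Nat.cast_pos.2 hn.1) hx)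
      ((div_le_one hx).2 ((Nat.le_floor_iff hx.le).1 hn.2))]
    push_cast
    rfl
  · intro n hn
    rcases eq_or_ne n 0 with rfl | h0
    · simp
    · have : ⌊x⌋₊ < n := by by_contra! h; exact hn (mem_Ioc.2 ⟨Nat.pos_of_ne_zero h0, h⟩)
      rw [tentWeight_of_one_le ((one_le_div hx).2 (Nat.lt_of_floor_lt this).le), mul_zero]

open Complex ArithmeticFunction MeasureTheory in
theorem integrable_logDeriv_riemannZeta₁_mul {σ x : ℝ} (hσ : 1 < σ) (hx : 0 < x) :
    Integrable fun y : ℝ ↦ deriv riemannZeta₁ (σ + y * I) / riemannZeta₁ (σ + y * I) *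
      ((x : ℂ) ^ (σ + y * I : ℂ) * (1 / ((σ + y * I : ℂ) * (σ + y * I + 1)))) := by
  have hs : ∀ y : ℝ, 1 < (σ + y * I : ℂ).re := fun y ↦ by simpa using hσ
  have hcont : Continuous fun y : ℝ ↦
      deriv riemannZeta₁ (σ + y * I) / riemannZeta₁ (σ + y * I) :=
    continuousOn_logDeriv_riemannZeta₁.comp_continuous (by fun_prop)
      fun y ↦ riemannZeta₁_ne_zero_of_one_le_re (hs y).le
  refine (integrable_cpow_mul_inv (by linarith) hx).bdd_mul hcont.aestronglyMeasurable
    (c := 1 / (σ - 1) + ‖LSeries (fun n ↦ (vonMangoldt n : ℂ)) σ‖) (ae_of_all _ fun y ↦ ?_)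
  have e : deriv riemannZeta₁ (σ + y * I) / riemannZeta₁ (σ + y * I) =
      1 / (σ + y * I - 1) - LSeries (fun n ↦ (vonMangoldt n : ℂ)) (σ + y * I) := by
    rw [LSeries_vonMangoldt_eq_inv_sub (hs y)]; ring
  have h1 : ‖(1 / (σ + y * I - 1) : ℂ)‖ ≤ 1 / (σ - 1) := by
    rw [norm_div, norm_one]
    have : σ - 1 ≤ ‖(σ + y * I - 1 : ℂ)‖ := by simpa using re_le_norm (σ + y * I - 1 : ℂ)
    have : 0 < σ - 1 := by linarith
    gcongr
  have h2 := norm_LSeries_le (f := fun n ↦ (vonMangoldt n : ℂ)) (g := fun n ↦ vonMangoldt n)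
    (s := σ + y * I) (fun n ↦ by simp [abs_of_nonneg vonMangoldt_nonneg])
    (LSeriesSummable_vonMangoldt (by simpa using hσ))
  have h3 : (σ + y * I : ℂ).re = σ := by simp
  rw [h3] at h2
  rw [e]
  exact (norm_sub_le _ _).trans (add_le_add h1 h2)

open Complex ArithmeticFunction MeasureTheory in
theorem sum_vonMangoldt_tent_sub_eq_integral {σ x : ℝ} (hσ : 1 < σ) (hx : 1 ≤ x) :
    ((∑ n ∈ Ioc 0 ⌊x⌋₊, vonMangoldt n * (1 - n / x) - (1 - 1 / x) ^ 2 * x / 2 : ℝ) : ℂ) =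
      -((1 / (2 * Real.pi) : ℝ) • ∫ y : ℝ,
        deriv riemannZeta₁ (σ + y * I) / riemannZeta₁ (σ + y * I) *
        ((x : ℂ) ^ (σ + y * I : ℂ) * (1 / ((σ + y * I : ℂ) * (σ + y * I + 1))))) := by
  have hx0 : 0 < x := by linarith
  have hs : ∀ y : ℝ, 1 < (σ + y * I : ℂ).re := fun y ↦ by simpa using hσ
  have hp := poleWeight_eq_integral hσ (u := 1 / x) (by positivity)
  rw [poleWeight_of_le_one (by positivity) ((div_le_one hx0).2 hx)] at hp
  have hpe : ((1 - 1 / x) ^ 2 * x / 2 : ℝ) =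
      ((1 - (1 / x : ℝ)) ^ 2 / (2 * (1 / x : ℝ)) : ℂ) := by
    have : (x : ℂ) ≠ 0 := ofReal_ne_zero.2 hx0.ne'
    push_cast
    field_simp
  have hpole : Integrable fun y : ℝ ↦ (x : ℂ) ^ (σ + y * I : ℂ) *
      (1 / (σ + y * I - 1) * (1 / ((σ + y * I : ℂ) * (σ + y * I + 1)))) := by
    refine (integrable_inv_sub_mul hσ).bdd_mul (c := x ^ σ) ?_ (ae_of_all _ fun y ↦ ?_)
    · exact (Continuous.const_cpow (by fun_prop)
        (Or.inl (ofReal_ne_zero.2 hx0.ne'))).aestronglyMeasurable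
    · simp [norm_cpow_eq_rpow_re_of_pos hx0]
  have hinv : ∀ s : ℂ, ((1 / x : ℝ) : ℂ) ^ (-s) = (x : ℂ) ^ s := fun s ↦ by
    rw [one_div, ofReal_inv, cpow_neg, inv_cpow _ _ (by
      rw [arg_ofReal_of_nonneg hx0.le]; exact Real.pi_pos.ne), inv_inv]
  simp only [hinv] at hp
  rw [ofReal_sub, sum_vonMangoldt_tent_eq_integral hσ hx0, hpe, hp, ← smul_sub,
    ← integral_sub _ hpole, ← smul_neg, ← integral_neg]
  · congr 2
    funext y
    rw [LSeries_vonMangoldt_eq_inv_sub (hs y)]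
    ring
  · refine (hpole.sub (integrable_logDeriv_riemannZeta₁_mul hσ hx0)).congr (ae_of_all _ fun y ↦ ?_)
    simp only [Pi.sub_apply]
    rw [LSeries_vonMangoldt_eq_inv_sub (hs y)]
    ring

theorem log_abs_add_four_sq_le (t : ℝ) :
    Real.log (|t| + 4) ^ 2 ≤ 32 * (1 + |t|) ^ (1 / 2 : ℝ) := by
  have ht := abs_nonneg t
  have h1 := Real.log_le_rpow_div (x := |t| + 4) (ε := 1 / 4) (by positivity) (by norm_num)
  have h0 : 0 ≤ Real.log (|t| + 4) := zero_le_one.trans (one_le_log_abs_add_four t)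
  calc Real.log (|t| + 4) ^ 2 ≤ ((|t| + 4) ^ (1 / 4 : ℝ) / (1 / 4)) ^ 2 := by gcongr
    _ = 16 * (|t| + 4) ^ (1 / 2 : ℝ) := by
      rw [div_pow, ← Real.rpow_natCast, ← Real.rpow_mul (by positivity)]
      norm_num; ring
    _ ≤ 16 * (4 * (1 + |t|)) ^ (1 / 2 : ℝ) := by gcongr; linarith
    _ = 32 * (1 + |t|) ^ (1 / 2 : ℝ) := by
      rw [Real.mul_rpow (by norm_num) (by positivity),
        show (4 : ℝ) ^ (1 / 2 : ℝ) = 2 by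
          rw [show (4 : ℝ) = 2 ^ (2 : ℝ) by norm_num, ← Real.rpow_mul (by norm_num)]; norm_num]
      ring

/-- The integrand of the Perron-type formula for the smoothed Chebyshev function. -/
noncomputable def perronIntegrand (x : ℝ) (s : ℂ) : ℂ :=
  deriv riemannZeta₁ s / riemannZeta₁ s * ((x : ℂ) ^ s * (1 / (s * (s + 1))))

open Complex in
theorem exists_norm_perronIntegrand_le : ∃ c > 0, c ≤ 1 / 4 ∧ ∃ C > 0, ∀ x : ℝ, 0 < x →
    ∀ s : ℂ, 1 - c / Real.log (|s.im| + 4) ≤ s.re → s.re ≤ 2 →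
      DifferentiableAt ℂ (perronIntegrand x) s ∧ ‖perronIntegrand x s‖ ≤
        C * x ^ s.re * ((1 + |s.im|) ^ (-(1 / 4) : ℝ) * (1 + |s.im|) ^ (-(5 / 4) : ℝ)) := by
  obtain ⟨c, hc0, hc, C, hC, H⟩ := exists_norm_logDeriv_riemannZeta₁_le
  refine ⟨c, hc0, hc, 256 * C, by positivity, fun x hx s h1 h2 ↦ ?_⟩
  obtain ⟨hz, hb⟩ := H s h1 h2
  have hL := one_le_log_abs_add_four s.im
  have hre : 1 / 2 ≤ s.re := by
    have : c / Real.log (|s.im| + 4) ≤ c := div_le_self hc0.le hL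
    linarith
  have hs0 : s ≠ 0 := by rintro rfl; norm_num at hre
  have hs1 : s + 1 ≠ 0 := fun h ↦ by
    have := congrArg re h; simp at this; linarith
  constructor
  · have hx0 : (x : ℂ) ≠ 0 := ofReal_ne_zero.2 hx.ne'
    exact ((differentiable_riemannZeta₁.deriv s).div (differentiable_riemannZeta₁ s) hz).mul
      ((differentiableAt_id.const_cpow (Or.inl hx0)).mul
        ((differentiableAt_const _).div (by fun_prop) (mul_ne_zero hs0 hs1)))
  · have hi := norm_inv_mul_add_one_le hre
    have hp : (0 : ℝ) < 1 + |s.im| := by positivity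
    have hq : (1 + s.im ^ 2)⁻¹ ≤ 2 * (1 + |s.im|) ^ (-2 : ℝ) := by
      rw [Real.rpow_neg hp.le, ← div_eq_mul_inv, inv_le_comm₀ (by positivity) (by positivity),
        inv_div, Real.rpow_two]
      nlinarith [sq_abs s.im, sq_nonneg (|s.im| - 1)]
    have hl := log_abs_add_four_sq_le s.im
    rw [perronIntegrand, norm_mul, norm_mul, norm_cpow_eq_rpow_re_of_pos hx]
    calc _ ≤ (C * (32 * (1 + |s.im|) ^ (1 / 2 : ℝ))) *
          (x ^ s.re * (4 * (2 * (1 + |s.im|) ^ (-2 : ℝ)))) := by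
          gcongr
          · exact hb.trans (by gcongr)
          · exact hi.trans (by gcongr)
      _ = 256 * C * x ^ s.re * ((1 + |s.im|) ^ (1 / 2 : ℝ) * (1 + |s.im|) ^ (-2 : ℝ)) := by ring
      _ = _ := by
        rw [← Real.rpow_add hp, ← Real.rpow_add hp]
        norm_num

open Complex MeasureTheory in
theorem exists_norm_integral_perronIntegrand_le : ∃ c > 0, c ≤ 1 / 4 ∧ ∃ C > 0, ∀ x : ℝ, 1 ≤ x →
    ∀ σ : ℝ, 1 < σ → σ ≤ 2 → ∀ T : ℝ, 1 ≤ T → ‖∫ y : ℝ, perronIntegrand x (σ + y * I)‖ ≤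
      C * (x ^ σ * T ^ (-(1 / 4) : ℝ) + x ^ (1 - c / Real.log (T + 4))) := by
  obtain ⟨c, hc0, hc, C, hC, H⟩ := exists_norm_perronIntegrand_le
  have hW : Integrable fun y : ℝ ↦ (1 + |y|) ^ (-(5 / 4) : ℝ) :=
    integrable_one_add_norm (by norm_num)
  have hW0 : ∀ y : ℝ, 0 ≤ (1 + |y|) ^ (-(5 / 4) : ℝ) := fun y ↦ by positivity
  set M := ∫ y : ℝ, (1 + |y|) ^ (-(5 / 4) : ℝ) with hM
  have hM0 : 0 ≤ M := integral_nonneg hW0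
  refine ⟨c, hc0, hc, C * (M + 4), by positivity, fun x hx σ h1 h2 T hT ↦ ?_⟩
  have hx0 : 0 < x := by linarith
  have hLT : 1 ≤ Real.log (T + 4) := by
    simpa [abs_of_pos (by linarith : 0 < T)] using one_le_log_abs_add_four T
  set σ₁ := 1 - c / Real.log (T + 4) with hσ₁
  have hcL : c / Real.log (T + 4) ≤ c := div_le_self hc0.le hLT
  have hcL0 : 0 < c / Real.log (T + 4) := by positivity
  have hreg : ∀ s : ℂ, |s.im| ≤ T → σ₁ ≤ s.re → 1 - c / Real.log (|s.im| + 4) ≤ s.re := by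
    intro s hs hs'
    have hl := one_le_log_abs_add_four s.im
    have : c / Real.log (T + 4) ≤ c / Real.log (|s.im| + 4) := by gcongr
    linarith
  have hreg' : ∀ s : ℂ, 1 ≤ s.re → 1 - c / Real.log (|s.im| + 4) ≤ s.re := by
    intro s hs
    have hl := one_le_log_abs_add_four s.im
    have : 0 ≤ c / Real.log (|s.im| + 4) := by positivity
    linarith
  have hT4 : ∀ y : ℝ, T ≤ |y| → (1 + |y|) ^ (-(1 / 4) : ℝ) ≤ T ^ (-(1 / 4) : ℝ) := fun y hy ↦
    Real.rpow_le_rpow_of_nonpos (by linarith) (by linarith) (by norm_num)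
  have hle1 : ∀ (y e : ℝ), e ≤ 0 → (1 + |y|) ^ e ≤ 1 := fun y e he ↦
    Real.rpow_le_one_of_one_le_of_nonpos (by linarith [abs_nonneg y]) he
  have hint : Integrable fun y : ℝ ↦ perronIntegrand x (σ + y * I) :=
    integrable_logDeriv_riemannZeta₁_mul h1 hx0
  -- the tail of the vertical integral
  have htail : ‖∫ y in (Set.Ioc (-T) T)ᶜ, perronIntegrand x (σ + y * I)‖ ≤
      C * x ^ σ * T ^ (-(1 / 4) : ℝ) * M := by
    have hg : Integrable fun y : ℝ ↦
        C * x ^ σ * T ^ (-(1 / 4) : ℝ) * (1 + |y|) ^ (-(5 / 4) : ℝ) := hW.const_mul _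
    calc _ ≤ ∫ y in (Set.Ioc (-T) T)ᶜ,
          C * x ^ σ * T ^ (-(1 / 4) : ℝ) * (1 + |y|) ^ (-(5 / 4) : ℝ) := by
          refine norm_integral_le_of_norm_le hg.integrableOn ?_
          filter_upwards [ae_restrict_mem measurableSet_Ioc.compl] with y hy
          have hy' : T ≤ |y| := by
            by_contra! h
            exact hy ⟨(abs_lt.1 h).1, (abs_lt.1 h).2.le⟩
          have := (H x hx0 (σ + y * I) (hreg' _ (by simpa using h1.le)) (by simpa using h2)).2
          simp only [add_re, ofReal_re, mul_re, I_re, mul_zero, ofReal_im, I_im, mul_one, sub_self,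
            add_zero, add_im, mul_im, zero_add] at this
          refine this.trans ?_
          rw [mul_assoc (C * x ^ σ)]
          exact mul_le_mul_of_nonneg_left
            (mul_le_mul_of_nonneg_right (hT4 y hy') (hW0 y)) (by positivity)
      _ ≤ ∫ y : ℝ, C * x ^ σ * T ^ (-(1 / 4) : ℝ) * (1 + |y|) ^ (-(5 / 4) : ℝ) :=
          setIntegral_le_integral hg (ae_of_all _ fun y ↦ by positivity)
      _ = _ := integral_const_mul _ _
  have hsplit : ∫ y : ℝ, perronIntegrand x (σ + y * I) =
      (∫ y in (-T)..T, perronIntegrand x (σ + y * I)) +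
        ∫ y in (Set.Ioc (-T) T)ᶜ, perronIntegrand x (σ + y * I) := by
    rw [intervalIntegral.integral_of_le (by linarith)]
    exact (integral_add_compl measurableSet_Ioc hint).symm
  -- the left side of the rectangle
  have hleft : ‖∫ y in (-T)..T, perronIntegrand x (σ₁ + y * I)‖ ≤ C * x ^ σ₁ * M := by
    have hg : Integrable fun y : ℝ ↦ C * x ^ σ₁ * (1 + |y|) ^ (-(5 / 4) : ℝ) := hW.const_mul _
    rw [intervalIntegral.integral_of_le (by linarith)]
    calc _ ≤ ∫ y in Set.Ioc (-T) T, C * x ^ σ₁ * (1 + |y|) ^ (-(5 / 4) : ℝ) := by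
          refine norm_integral_le_of_norm_le hg.integrableOn ?_
          filter_upwards [ae_restrict_mem measurableSet_Ioc] with y hy
          have := (H x hx0 (σ₁ + y * I) (hreg _ (by simpa [abs_le] using ⟨hy.1.le, hy.2⟩)
            (by simp)) (by simp; linarith)).2
          simp only [add_re, ofReal_re, mul_re, I_re, mul_zero, ofReal_im, I_im, mul_one, sub_self,
            add_zero, add_im, mul_im, zero_add] at this
          refine this.trans ?_
          gcongr
          exact mul_le_of_le_one_left (hW0 y) (hle1 y _ (by norm_num))
      _ ≤ ∫ y : ℝ, C * x ^ σ₁ * (1 + |y|) ^ (-(5 / 4) : ℝ) :=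
          setIntegral_le_integral hg (ae_of_all _ fun y ↦ by positivity)
      _ = _ := integral_const_mul _ _
  -- the horizontal sides of the rectangle
  have hhor : ∀ t : ℝ, |t| = T → ‖∫ u in σ₁..σ, perronIntegrand x (u + t * I)‖ ≤
      C * x ^ σ * T ^ (-(1 / 4) : ℝ) * 2 := by
    intro t ht
    have hle : σ₁ ≤ σ := by linarith
    refine (intervalIntegral.norm_integral_le_of_norm_le_const
      (C := C * x ^ σ * T ^ (-(1 / 4) : ℝ)) fun u hu ↦ ?_).trans ?_
    · rw [Set.uIoc_of_le hle] at hu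
      have := (H x hx0 (u + t * I) (hreg _ (by simp [ht]) (by simpa using hu.1.le))
        (by simpa using hu.2.trans h2)).2
      simp only [add_re, ofReal_re, mul_re, I_re, mul_zero, ofReal_im, I_im, mul_one, sub_self,
        add_zero, add_im, mul_im, zero_add] at this
      refine this.trans ?_
      have e1 : x ^ u ≤ x ^ σ := Real.rpow_le_rpow_of_exponent_le hx hu.2
      have e2 := hT4 t ht.ge
      have e3 := hle1 t (-(5 / 4)) (by norm_num)
      calc _ ≤ C * x ^ σ * (T ^ (-(1 / 4) : ℝ) * 1) := by gcongr
        _ = _ := by ring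
    · rw [abs_of_nonneg (by linarith)]
      gcongr
      linarith
  have hrect := integral_boundary_rect_eq_zero_of_differentiableOn (perronIntegrand x)
    (⟨σ₁, -T⟩ : ℂ) (⟨σ, T⟩ : ℂ) (by
      intro s hs
      rw [mem_reProdIm, Set.uIcc_of_le (by simp; linarith),
        Set.uIcc_of_le (by simp; linarith)] at hs
      exact (H x hx0 s (hreg s (abs_le.2 hs.2) hs.1.1)
        (hs.1.2.trans h2)).1.differentiableWithinAt)
  simp only [smul_eq_mul] at hrect
  have hbot := hhor (-T) (by rw [abs_neg, abs_of_pos (by linarith)])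
  have htop := hhor T (abs_of_pos (by linarith))
  set A := ∫ u in σ₁..σ, perronIntegrand x (u + (-T : ℝ) * I)
  set B := ∫ u in σ₁..σ, perronIntegrand x (u + T * I)
  set D := ∫ y in (-T)..T, perronIntegrand x (σ₁ + y * I)
  set E := ∫ y in (-T)..T, perronIntegrand x (σ + y * I)
  set F := ∫ y in (Set.Ioc (-T) T)ᶜ, perronIntegrand x (σ + y * I)
  have hE : E = D + I * A - I * B := by
    have : I * (A - B + I * E - I * D) = 0 := by rw [hrect, mul_zero]
    linear_combination (-1 : ℂ) * this + (E - D) * I_sq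
  rw [hsplit, hE]
  calc _ ≤ ‖D‖ + ‖I * A‖ + ‖I * B‖ + ‖F‖ :=
        (norm_add_le _ _).trans (by
          gcongr; exact (norm_sub_le _ _).trans (by gcongr; exact norm_add_le _ _))
    _ = ‖D‖ + ‖A‖ + ‖B‖ + ‖F‖ := by simp
    _ ≤ C * x ^ σ₁ * M + C * x ^ σ * T ^ (-(1 / 4) : ℝ) * 2 + C * x ^ σ * T ^ (-(1 / 4) : ℝ) * 2 +
        C * x ^ σ * T ^ (-(1 / 4) : ℝ) * M := by gcongr
    _ ≤ _ := by
      have : 0 ≤ C * x ^ σ₁ * 4 := by positivity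
      linarith

open Complex ArithmeticFunction in
theorem exists_sum_vonMangoldt_tent_sub_le : ∃ K > 0, K ≤ 1 ∧ ∃ C > 0, ∀ x : ℝ, Real.exp 1 ≤ x →
    |∑ n ∈ Ioc 0 ⌊x⌋₊, vonMangoldt n * (1 - n / x) - x / 2| ≤
      C * x * Real.exp (-K * √(Real.log x)) := by
  obtain ⟨c, hc0, hc, C, hC, H⟩ := exists_norm_integral_perronIntegrand_le
  refine ⟨c / 3, by positivity, by linarith, C * (Real.exp 1 + 1) + 1, by positivity,
    fun x hx ↦ ?_⟩
  have hx1 : 1 ≤ x := (Real.one_le_exp zero_le_one).trans hx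
  have hx0 : 0 < x := by linarith
  have hl : 1 ≤ Real.log x := (Real.le_log_iff_exp_le hx0).2 hx
  have hl0 : 0 < Real.log x := by linarith
  set u := √(Real.log x) with hu
  have hu2 : u ^ 2 = Real.log x := Real.sq_sqrt hl0.le
  have hu1 : 1 ≤ u := Real.one_le_sqrt.2 hl
  have hxe : x = Real.exp (u ^ 2) := by rw [hu2, Real.exp_log hx0]
  set E := Real.exp (-(c / 3) * u) with hE
  have hσ : 1 < 1 + 1 / Real.log x := by linarith [one_div_pos.2 hl0]
  have hσ2 : 1 + 1 / Real.log x ≤ 2 := by linarith [(div_le_one hl0).2 hl]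
  have hT : 1 ≤ Real.exp u := Real.one_le_exp (by linarith)
  have h := H x hx1 _ hσ hσ2 _ hT
  have h1 : x ^ (1 + 1 / Real.log x) * Real.exp u ^ (-(1 / 4) : ℝ) ≤ Real.exp 1 * x * E := by
    rw [Real.rpow_def_of_pos hx0, ← Real.exp_mul, hxe, hE, ← Real.exp_add, ← Real.exp_add,
      ← Real.exp_add, Real.log_exp, Real.exp_le_exp]
    field_simp
    nlinarith
  have h2 : x ^ (1 - c / Real.log (Real.exp u + 4)) ≤ x * E := by
    have hL : Real.log (Real.exp u + 4) ≤ 3 * u := by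
      rw [Real.log_le_iff_le_exp (by positivity), show 3 * u = u + 2 * u by ring, Real.exp_add]
      have : Real.exp 2 ≤ Real.exp (2 * u) := by gcongr; linarith
      have : 1 + 2 + 2 ^ 2 / 2 ≤ Real.exp 2 := Real.quadratic_le_exp_of_nonneg (by norm_num)
      nlinarith
    have hL0 : 0 < Real.log (Real.exp u + 4) := Real.log_pos (by linarith)
    rw [Real.rpow_def_of_pos hx0, hE, ← hu2, hxe, ← Real.exp_add, Real.exp_le_exp]
    have : c / (3 * u) ≤ c / Real.log (Real.exp u + 4) := by gcongr
    have e : u ^ 2 * (c / (3 * u)) = c / 3 * u := by field_simp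
    nlinarith [mul_le_mul_of_nonneg_left this (sq_nonneg u)]
  have h3 : 1 ≤ x * E := by
    rw [hxe, hE, ← Real.exp_add]
    exact Real.one_le_exp (by nlinarith)
  have hk := sum_vonMangoldt_tent_sub_eq_integral hσ hx1
  have hk2 := congrArg norm hk
  rw [norm_real, Real.norm_eq_abs, norm_neg, norm_smul, Real.norm_of_nonneg (by positivity)] at hk2
  have hpi : 1 / (2 * Real.pi) ≤ 1 := by
    rw [div_le_one (by positivity)]; linarith [Real.pi_gt_three]
  have h4 : |∑ n ∈ Ioc 0 ⌊x⌋₊, vonMangoldt n * (1 - n / x) - (1 - 1 / x) ^ 2 * x / 2| ≤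
      C * (Real.exp 1 + 1) * (x * E) := by
    rw [hk2]
    refine (mul_le_of_le_one_left (norm_nonneg _) hpi).trans (h.trans ?_)
    nlinarith
  have h5 : |(1 - 1 / x) ^ 2 * x / 2 - x / 2| ≤ 1 := by
    have : (1 - 1 / x) ^ 2 * x / 2 - x / 2 = -1 + 1 / x / 2 := by field_simp; ring
    rw [this, abs_le]
    have : 1 / x ≤ 1 := (div_le_one hx0).2 hx1
    have : 0 < 1 / x := by positivity
    constructor <;> linarith
  calc _ ≤ _ := abs_sub_le _ ((1 - 1 / x) ^ 2 * x / 2) _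
    _ ≤ C * (Real.exp 1 + 1) * (x * E) + x * E := add_le_add h4 (h5.trans h3)
    _ = _ := by ring

open ArithmeticFunction in
theorem sub_mul_psi_le {x y : ℝ} (hx : 0 < x) (hy : 0 < y) :
    (y - x) * Chebyshev.psi x ≤ y * ∑ n ∈ Ioc 0 ⌊y⌋₊, vonMangoldt n * (1 - n / y) -
      x * ∑ n ∈ Ioc 0 ⌊x⌋₊, vonMangoldt n * (1 - n / x) := by
  have key : ∀ z : ℝ, 0 < z → z * ∑ n ∈ Ioc 0 ⌊z⌋₊, vonMangoldt n * (1 - n / z) =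
      ∑ n ∈ Ioc 0 ⌊z⌋₊, vonMangoldt n * (z - n) := fun z hz ↦ by
    rw [mul_sum]
    refine sum_congr rfl fun n _ ↦ ?_
    field_simp
  have hle : ∀ n ∈ Ioc 0 ⌊x⌋₊ \ Ioc 0 ⌊y⌋₊, vonMangoldt n * (y - n) ≤ 0 := fun n hn ↦ by
    simp only [mem_sdiff, mem_Ioc, not_and, not_le] at hn
    have := Nat.lt_of_floor_lt (hn.2 hn.1.1)
    exact mul_nonpos_of_nonneg_of_nonpos vonMangoldt_nonneg (by linarith)
  have hge : ∀ n ∈ Ioc 0 ⌊y⌋₊ \ Ioc 0 ⌊x⌋₊, 0 ≤ vonMangoldt n * (y - n) := fun n hn ↦ by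
    simp only [mem_sdiff, mem_Ioc, not_and, not_le] at hn
    have := (Nat.le_floor_iff hy.le).1 hn.1.2
    exact mul_nonneg vonMangoldt_nonneg (by linarith)
  have h1 : ∑ n ∈ Ioc 0 ⌊x⌋₊, vonMangoldt n * (y - n) ≤
      ∑ n ∈ Ioc 0 ⌊y⌋₊, vonMangoldt n * (y - n) := by
    have := sum_sdiff_sub_sum_sdiff (s₁ := Ioc 0 ⌊x⌋₊) (s₂ := Ioc 0 ⌊y⌋₊)
      (f := fun n : ℕ ↦ vonMangoldt n * (y - n))
    linarith [sum_nonpos hle, sum_nonneg hge]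
  rw [key x hx, key y hy, le_sub_iff_add_le, Chebyshev.psi, mul_sum, ← sum_add_distrib]
  refine le_trans (sum_le_sum fun n _ ↦ le_of_eq ?_) h1
  ring

theorem sq_mul_exp_neg_sqrt_log_le {K y z : ℝ} (hK : K ≤ 1) (hy : Real.exp 1 ≤ y) (hyz : y ≤ z) :
    y ^ 2 * Real.exp (-K * √(Real.log y)) ≤ z ^ 2 * Real.exp (-K * √(Real.log z)) := by
  have key : ∀ t : ℝ, Real.exp 1 ≤ t → t ^ 2 * Real.exp (-K * √(Real.log t)) =
      Real.exp (2 * √(Real.log t) ^ 2 - K * √(Real.log t)) := fun t ht ↦ by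
    have ht0 : 0 < t := (Real.exp_pos 1).trans_le ht
    have hl : 1 ≤ Real.log t := (Real.le_log_iff_exp_le ht0).2 ht
    rw [Real.sq_sqrt (by linarith), sub_eq_add_neg, Real.exp_add, two_mul, Real.exp_add,
      Real.exp_log ht0, sq, neg_mul]
  have hy0 : 0 < y := (Real.exp_pos 1).trans_le hy
  have hl : 1 ≤ Real.log y := (Real.le_log_iff_exp_le hy0).2 hy
  rw [key y hy, key z (hy.trans hyz), Real.exp_le_exp]
  have h1 : 1 ≤ √(Real.log y) := Real.one_le_sqrt.2 hl
  have h2 : √(Real.log y) ≤ √(Real.log z) := Real.sqrt_le_sqrt (Real.log_le_log hy0 hyz)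
  nlinarith

open ArithmeticFunction in
theorem exists_abs_psi_sub_le : ∃ K > 0, K ≤ 1 ∧ ∃ C > 0, ∀ x : ℝ, 2 * Real.exp 1 ≤ x →
    |Chebyshev.psi x - x| ≤ C * x * Real.exp (-K * √(Real.log x)) := by
  obtain ⟨K, hK0, hK, C, hC, H⟩ := exists_sum_vonMangoldt_tent_sub_le
  refine ⟨K / 2, by positivity, by linarith, 1 / 4 + 9 * C, by positivity, fun x hx ↦ ?_⟩
  have he := Real.exp_pos 1
  have hx0 : 0 < x := by linarith
  set f : ℝ → ℝ := fun z ↦ z * ∑ n ∈ Ioc 0 ⌊z⌋₊, vonMangoldt n * (1 - n / z) with hf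
  set δ := Real.exp (-(K / 2) * √(Real.log x)) with hδ
  have hδ0 : 0 < δ := Real.exp_pos _
  have hδ1 : δ ≤ 1 := Real.exp_le_one_iff.2 (by
    have := Real.sqrt_nonneg (Real.log x); nlinarith)
  have hδ2 : Real.exp (-K * √(Real.log x)) = δ ^ 2 := by
    rw [hδ, ← Real.exp_nat_mul]; congr 1; push_cast; ring
  have hfb : ∀ y : ℝ, Real.exp 1 ≤ y → y ≤ 3 / 2 * x →
      |f y - y ^ 2 / 2| ≤ 9 / 4 * C * (x ^ 2 * δ ^ 2) := by
    intro y hy hyx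
    have hy0 : 0 < y := he.trans_le hy
    have h1 : f y - y ^ 2 / 2 =
        y * (∑ n ∈ Ioc 0 ⌊y⌋₊, vonMangoldt n * (1 - n / y) - y / 2) := by rw [hf]; ring
    have h2 : Real.exp (-K * √(Real.log (3 / 2 * x))) ≤ δ ^ 2 := by
      rw [← hδ2, Real.exp_le_exp]
      have : √(Real.log x) ≤ √(Real.log (3 / 2 * x)) :=
        Real.sqrt_le_sqrt (Real.log_le_log hx0 (by linarith))
      nlinarith
    rw [h1, abs_mul, abs_of_pos hy0]
    calc _ ≤ y * (C * y * Real.exp (-K * √(Real.log y))) := by gcongr; exact H y hy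
      _ = C * (y ^ 2 * Real.exp (-K * √(Real.log y))) := by ring
      _ ≤ C * ((3 / 2 * x) ^ 2 * Real.exp (-K * √(Real.log (3 / 2 * x)))) := by
        gcongr ?_ * ?_
        exact sq_mul_exp_neg_sqrt_log_le hK hy hyx
      _ ≤ C * ((3 / 2 * x) ^ 2 * δ ^ 2) := by gcongr
      _ = _ := by ring
  set h := x * δ / 2 with hh
  have hh0 : 0 < h := by positivity
  have hhx : h ≤ x / 2 := by rw [hh]; nlinarith
  have hp := sub_mul_psi_le hx0 (y := x + h) (by linarith)
  have hm := sub_mul_psi_le hx0 (y := x - h) (by linarith)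
  change _ ≤ f (x + h) - f x at hp
  change _ ≤ f (x - h) - f x at hm
  have b0 := abs_le.1 (hfb x (by linarith) (by linarith))
  have b1 := abs_le.1 (hfb (x + h) (by linarith) (by linarith))
  have b2 := abs_le.1 (hfb (x - h) (by linarith) (by linarith))
  have hsq : x ^ 2 * δ ^ 2 = h * (2 * (x * δ)) := by rw [hh]; ring
  rw [hsq] at b0 b1 b2
  have hhh : h ^ 2 / 2 = h * (1 / 4 * (x * δ)) := by rw [hh]; ring
  rw [abs_le]
  constructor
  · refine le_of_mul_le_mul_left ?_ hh0
    nlinarith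
  · refine le_of_mul_le_mul_left ?_ hh0
    nlinarith

theorem exists_abs_theta_sub_le : ∃ K > 0, K ≤ 1 ∧ ∃ C > 0, ∀ x : ℝ, 2 ≤ x →
    |Chebyshev.theta x - x| ≤ C * x * Real.exp (-K * √(Real.log x)) := by
  obtain ⟨K, hK0, hK, C, hC, H⟩ := exists_abs_psi_sub_le
  refine ⟨K, hK0, hK, C + 8 * Real.exp 1 + 2 * Real.exp 2, by positivity, fun x hx ↦ ?_⟩
  have hx0 : 0 < x := by linarith
  have hl0 : 0 ≤ Real.log x := Real.log_nonneg (by linarith)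
  set u := √(Real.log x) with hu
  have hu0 : 0 ≤ u := Real.sqrt_nonneg _
  have hu2 : u ^ 2 = Real.log x := Real.sq_sqrt hl0
  have hE := Real.exp_pos (-K * u)
  have he := Real.exp_pos 1
  rcases le_total (2 * Real.exp 1) x with h | h
  · have h1 : 2 * √x * Real.log x ≤ 8 * Real.exp 1 * x * Real.exp (-K * u) := by
      have hl := Real.log_le_rpow_div hx0.le (ε := 1 / 4) (by norm_num)
      calc 2 * √x * Real.log x ≤ 2 * x ^ (1 / 2 : ℝ) * (x ^ (1 / 4 : ℝ) / (1 / 4)) := by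
            rw [Real.sqrt_eq_rpow]; gcongr
        _ = 8 * (x ^ (1 / 2 : ℝ) * x ^ (1 / 4 : ℝ)) := by ring
        _ = 8 * Real.exp (3 / 4 * u ^ 2) := by
            rw [← Real.rpow_add hx0, Real.rpow_def_of_pos hx0, hu2]; norm_num; ring
        _ ≤ 8 * Real.exp (1 + u ^ 2 + -K * u) := by
            gcongr
            nlinarith [sq_nonneg (u / 2 - K)]
        _ = _ := by rw [Real.exp_add, Real.exp_add, hu2, Real.exp_log hx0]; ring
    have h2 := Chebyshev.abs_psi_sub_theta_le_sqrt_mul_log (x := x) (by linarith)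
    rw [abs_sub_comm] at h2
    calc _ ≤ _ := abs_sub_le _ (Chebyshev.psi x) _
      _ ≤ 8 * Real.exp 1 * x * Real.exp (-K * u) + C * x * Real.exp (-K * u) :=
        add_le_add (h2.trans h1) (H x h)
      _ ≤ _ := by
        have : 0 ≤ 2 * Real.exp 2 * x * Real.exp (-K * u) := by positivity
        linarith
  · have h1 : 1 ≤ Real.exp 2 * Real.exp (-K * u) := by
      rw [← Real.exp_add]
      refine Real.one_le_exp ?_
      have : Real.log x ≤ 2 := by
        rw [Real.log_le_iff_le_exp hx0, show (2 : ℝ) = 1 + 1 by norm_num, Real.exp_add]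
        have := Real.add_one_le_exp (1 : ℝ)
        nlinarith
      have : u ≤ 2 := by nlinarith
      nlinarith
    have h2 := Chebyshev.theta_le_log4_mul_x hx0.le
    have h3 := Chebyshev.theta_nonneg x
    have h4 : Real.log 4 ≤ 3 := (Real.log_le_sub_one_of_pos (by norm_num)).trans (by norm_num)
    calc |Chebyshev.theta x - x| ≤ 2 * x := by
          rw [abs_le]; constructor <;> nlinarith
      _ ≤ 2 * x * (Real.exp 2 * Real.exp (-K * u)) := le_mul_of_one_le_right (by positivity) h1
      _ ≤ _ := by
        have : 0 ≤ (C + 8 * Real.exp 1) * x * Real.exp (-K * u) := by positivity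
        linarith

theorem hasDerivAt_inv_mul_log {t : ℝ} (ht : 1 < t) :
    HasDerivAt (fun t ↦ (t * Real.log t)⁻¹) (-(Real.log t + 1) / (t * Real.log t) ^ 2) t := by
  have ht0 : t ≠ 0 := by linarith
  have hl := Real.log_pos ht
  have h := ((hasDerivAt_id t).mul (Real.hasDerivAt_log ht0)).inv (mul_ne_zero ht0 hl.ne')
  refine h.congr_deriv ?_
  simp [ht0]

open MeasureTheory in
theorem sum_inv_prime_sub_eq {X Y : ℝ} (hX : 3 ≤ X) (hXY : X ≤ Y) :
    (∑ p ∈ (Icc 1 ⌊Y⌋₊).filter Nat.Prime, (1 : ℝ) / p - Real.log (Real.log Y)) -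
      (∑ p ∈ (Icc 1 ⌊X⌋₊).filter Nat.Prime, (1 : ℝ) / p - Real.log (Real.log X)) =
    (Chebyshev.theta Y - Y) / (Y * Real.log Y) - (Chebyshev.theta X - X) / (X * Real.log X) +
      ∫ t in Set.Ioc X Y,
        (Real.log t + 1) / (t * Real.log t) ^ 2 * (Chebyshev.theta t - t) := by
  have hX0 : 0 < X := by linarith
  set g : ℝ → ℝ := fun t ↦ (Real.log t + 1) / (t * Real.log t) ^ 2 with hg
  have h1 : ∀ t ∈ Set.Icc X Y, 1 < t := fun t ht ↦ by linarith [ht.1]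
  have hd : ∀ t ∈ Set.Icc X Y, HasDerivAt (fun t ↦ (t * Real.log t)⁻¹) (-g t) t := fun t ht ↦ by
    simpa only [hg, ← neg_div] using hasDerivAt_inv_mul_log (h1 t ht)
  have hgc : ContinuousOn g (Set.Icc X Y) := by
    have hlog : ContinuousOn Real.log (Set.Icc X Y) :=
      Real.continuousOn_log.mono fun t ht ↦ (zero_lt_one.trans (h1 t ht)).ne'
    refine ContinuousOn.div (by fun_prop) (by fun_prop) fun t ht ↦ ?_
    have := Real.log_pos (h1 t ht)
    have := h1 t ht
    positivity
  have hgi : IntegrableOn g (Set.Icc X Y) := hgc.integrableOn_Icc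
  set c : ℕ → ℝ := fun n ↦ if n.Prime then Real.log n else 0 with hc
  have hθ : ∀ t : ℝ, ∑ k ∈ Icc 0 ⌊t⌋₊, c k = Chebyshev.theta t := fun t ↦ by
    rw [Chebyshev.theta_eq_sum_Icc, sum_filter]
  have habel := sum_mul_eq_sub_sub_integral_mul c hX0.le hXY
    (fun t ht ↦ (hd t ht).differentiableAt)
    (hgi.neg.congr_fun (fun t ht ↦ (hd t ht).deriv.symm) measurableSet_Icc)
  have hgθ : IntegrableOn (fun t ↦ g t * Chebyshev.theta t) (Set.Ioc X Y) := by
    simpa only [hθ] using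
      (integrableOn_mul_sum_Icc c (m := 0) hX0.le hgi).mono_set Set.Ioc_subset_Icc_self
  have hgt : IntegrableOn (fun t ↦ g t * t) (Set.Ioc X Y) :=
    (hgc.mul continuousOn_id).integrableOn_Icc.mono_set Set.Ioc_subset_Icc_self
  simp only [hθ] at habel
  have hderiv : ∫ t in Set.Ioc X Y, deriv (fun t ↦ (t * Real.log t)⁻¹) t * Chebyshev.theta t =
      -∫ t in Set.Ioc X Y, g t * Chebyshev.theta t := by
    rw [← integral_neg]
    refine setIntegral_congr_fun measurableSet_Ioc fun t ht ↦ ?_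
    simp only [(hd t (Set.Ioc_subset_Icc_self ht)).deriv, neg_mul]
  have hmain : ∫ t in Set.Ioc X Y, g t * t =
      (Real.log (Real.log Y) - (Real.log Y)⁻¹) - (Real.log (Real.log X) - (Real.log X)⁻¹) := by
    rw [← intervalIntegral.integral_of_le hXY]
    refine intervalIntegral.integral_eq_sub_of_hasDerivAt
      (f := fun t ↦ Real.log (Real.log t) - (Real.log t)⁻¹) (fun t ht ↦ ?_)
      ((intervalIntegrable_iff_integrableOn_Ioc_of_le hXY).2 hgt)
    rw [Set.uIcc_of_le hXY] at ht
    have ht0 : 0 < t := zero_lt_one.trans (h1 t ht)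
    have hl := Real.log_pos (h1 t ht)
    have h := Real.hasDerivAt_log ht0.ne'
    refine ((h.log hl.ne').sub (h.inv hl.ne')).congr_deriv ?_
    simp only [hg]
    field_simp
    ring
  have hS : ∀ t : ℝ, ∑ p ∈ (Icc 1 ⌊t⌋₊).filter Nat.Prime, (1 : ℝ) / p =
      ∑ k ∈ Ioc 0 ⌊t⌋₊, ((k : ℝ) * Real.log k)⁻¹ * c k := fun t ↦ by
    rw [sum_filter]
    refine sum_congr rfl fun k _ ↦ ?_
    simp only [hc]
    split_ifs with hk
    · have := Real.log_pos (Nat.one_lt_cast.2 hk.one_lt : (1 : ℝ) < k)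
      have : (0 : ℝ) < k := Nat.cast_pos.2 hk.pos
      field_simp
    · simp
  have hsplit := sum_Ioc_consecutive (fun k : ℕ ↦ ((k : ℝ) * Real.log k)⁻¹ * c k)
    (Nat.zero_le ⌊X⌋₊) (Nat.floor_le_floor hXY)
  have hdiv : ∀ t : ℝ, 3 ≤ t → (Chebyshev.theta t - t) / (t * Real.log t) =
      (t * Real.log t)⁻¹ * Chebyshev.theta t - (Real.log t)⁻¹ := fun t ht ↦ by
    have := Real.log_pos (by linarith : 1 < t)
    field_simp
  simp only [mul_sub]
  rw [integral_sub hgθ hgt, hmain, hS, hS, hdiv X hX, hdiv Y (hX.trans hXY)]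
  rw [hderiv] at habel
  linarith

open MeasureTheory in
theorem integral_exp_neg_sqrt_log_le {K X Y : ℝ} (hK : 0 < K) (hX : 3 ≤ X) (hXY : X ≤ Y) :
    IntegrableOn (fun t ↦ Real.exp (-K * √(Real.log t)) / (t * √(Real.log t))) (Set.Ioc X Y) ∧
    ∫ t in Set.Ioc X Y, Real.exp (-K * √(Real.log t)) / (t * √(Real.log t)) ≤
      2 / K * Real.exp (-K * √(Real.log X)) := by
  have hpos : ∀ t ∈ Set.uIcc X Y, 0 < t ∧ 0 < Real.log t := fun t ht ↦ by
    rw [Set.uIcc_of_le hXY] at ht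
    exact ⟨by linarith [ht.1], Real.log_pos (by linarith [ht.1])⟩
  have hd : ∀ t ∈ Set.uIcc X Y, HasDerivAt (fun t ↦ -(2 / K) * Real.exp (-K * √(Real.log t)))
      (Real.exp (-K * √(Real.log t)) / (t * √(Real.log t))) t := fun t ht ↦ by
    obtain ⟨h0, hl⟩ := hpos t ht
    have h := ((((Real.hasDerivAt_log h0.ne').sqrt hl.ne').const_mul (-K)).exp).const_mul (-(2 / K))
    refine h.congr_deriv ?_
    have := Real.sqrt_pos.2 hl
    field_simp
  have hc : ContinuousOn (fun t ↦ Real.exp (-K * √(Real.log t)) / (t * √(Real.log t)))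
      (Set.uIcc X Y) := by
    have hlog : ContinuousOn Real.log (Set.uIcc X Y) :=
      Real.continuousOn_log.mono fun t ht ↦ (hpos t ht).1.ne'
    refine ContinuousOn.div (by fun_prop) (by fun_prop) fun t ht ↦ ?_
    exact mul_ne_zero (hpos t ht).1.ne' (Real.sqrt_pos.2 (hpos t ht).2).ne'
  have hi := hc.intervalIntegrable (μ := volume)
  refine ⟨(intervalIntegrable_iff_integrableOn_Ioc_of_le hXY).1 hi, ?_⟩
  rw [← intervalIntegral.integral_of_le hXY, intervalIntegral.integral_eq_sub_of_hasDerivAt hd hi]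
  have : 0 < 2 / K * Real.exp (-K * √(Real.log Y)) := by positivity
  linarith

open MeasureTheory in
theorem exists_abs_sum_inv_prime_sub_le : ∃ K > 0, ∃ C > 0, ∀ X : ℝ, 3 ≤ X → ∀ Y : ℝ, X ≤ Y →
    |(∑ p ∈ (Icc 1 ⌊Y⌋₊).filter Nat.Prime, (1 : ℝ) / p - Real.log (Real.log Y)) -
      (∑ p ∈ (Icc 1 ⌊X⌋₊).filter Nat.Prime, (1 : ℝ) / p - Real.log (Real.log X))| ≤
    C * Real.exp (-K * √(Real.log X)) := by
  obtain ⟨K, hK0, -, C, hC, H⟩ := exists_abs_theta_sub_le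
  refine ⟨K, hK0, C + C + 2 * C * (2 / K), by positivity, fun X hX Y hXY ↦ ?_⟩
  rw [sum_inv_prime_sub_eq hX hXY]
  have hl : ∀ t : ℝ, 3 ≤ t → 1 ≤ Real.log t := fun t ht ↦
    (Real.le_log_iff_exp_le (by linarith)).2 (Real.exp_one_lt_three.le.trans ht)
  have hb : ∀ t : ℝ, X ≤ t → |(Chebyshev.theta t - t) / (t * Real.log t)| ≤
      C * Real.exp (-K * √(Real.log X)) := fun t ht ↦ by
    have ht0 : 0 < t := by linarith
    have h1 := hl t (hX.trans ht)
    have hs : √(Real.log X) ≤ √(Real.log t) :=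
      Real.sqrt_le_sqrt (Real.log_le_log (by linarith) ht)
    rw [abs_div, abs_of_pos (by positivity : 0 < t * Real.log t), div_le_iff₀ (by positivity)]
    calc _ ≤ C * t * Real.exp (-K * √(Real.log t)) := H t (by linarith)
      _ ≤ C * t * Real.exp (-K * √(Real.log X)) * 1 := by
        rw [mul_one]; gcongr C * t * Real.exp ?_; nlinarith
      _ ≤ C * t * Real.exp (-K * √(Real.log X)) * Real.log t := by gcongr
      _ = _ := by ring
  obtain ⟨hi, hI⟩ := integral_exp_neg_sqrt_log_le hK0 hX hXY
  have hint : |∫ t in Set.Ioc X Y,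
      (Real.log t + 1) / (t * Real.log t) ^ 2 * (Chebyshev.theta t - t)| ≤
        2 * C * (2 / K) * Real.exp (-K * √(Real.log X)) := by
    have := norm_integral_le_of_norm_le (μ := volume.restrict (Set.Ioc X Y))
      (f := fun t ↦ (Real.log t + 1) / (t * Real.log t) ^ 2 * (Chebyshev.theta t - t))
      (hi.const_mul (2 * C)) (by
        filter_upwards [ae_restrict_mem measurableSet_Ioc] with t ht
        have ht3 : 3 ≤ t := by linarith [ht.1]
        have ht0 : 0 < t := by linarith
        have h1 := hl t ht3
        have hs := Real.sqrt_pos.2 (by linarith : 0 < Real.log t)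
        have hs2 := Real.sq_sqrt (by linarith : 0 ≤ Real.log t)
        have hs1 : 1 ≤ √(Real.log t) := Real.one_le_sqrt.2 h1
        rw [norm_mul, Real.norm_of_nonneg (by positivity), Real.norm_eq_abs]
        calc _ ≤ (2 * Real.log t) / (t * Real.log t) ^ 2 *
              (C * t * Real.exp (-K * √(Real.log t))) := by
              gcongr
              · linarith
              · exact H t (by linarith)
          _ = 2 * C * (Real.exp (-K * √(Real.log t)) / (t * Real.log t)) := by field_simp
          _ ≤ 2 * C * (Real.exp (-K * √(Real.log t)) / (t * √(Real.log t))) := by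
              gcongr
              nlinarith)
    rw [integral_const_mul] at this
    refine this.trans ?_
    rw [mul_assoc (2 * C)]
    exact mul_le_mul_of_nonneg_left hI (by positivity)
  calc _ ≤ _ := abs_add_le _ _
    _ ≤ C * Real.exp (-K * √(Real.log X)) + C * Real.exp (-K * √(Real.log X)) +
        2 * C * (2 / K) * Real.exp (-K * √(Real.log X)) := by
      refine add_le_add ((abs_sub _ _).trans (add_le_add (hb Y hXY) (hb X le_rfl))) hint
    _ = _ := by ring

/-- Mertens' second theorem with de la Vallée Poussin error term: there are constants
`c` and `K₁ > 0` with `∑_{p ≤ X} 1/p = log log X + c + O(e^{-K₁ √(log X)})`. -/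
theorem mertens_second_with_error :
    ∃ c : ℝ, ∃ K₁ > (0 : ℝ), ∃ C > (0 : ℝ), ∀ X : ℝ, 3 ≤ X →
      |(∑ p ∈ (Finset.Icc 1 ⌊X⌋₊).filter Nat.Prime, (1 : ℝ) / p)
          - (Real.log (Real.log X) + c)| ≤
        C * Real.exp (-K₁ * Real.sqrt (Real.log X)) := by
  obtain ⟨K, hK, C, hC, H⟩ := exists_abs_sum_inv_prime_sub_le
  set D : ℝ → ℝ := fun X ↦
    ∑ p ∈ (Icc 1 ⌊X⌋₊).filter Nat.Prime, (1 : ℝ) / p - Real.log (Real.log X) with hD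
  have hlim : Filter.Tendsto (fun X ↦ C * Real.exp (-K * √(Real.log X))) Filter.atTop (nhds 0) := by
    have h := (Real.tendsto_sqrt_atTop.comp Real.tendsto_log_atTop).const_mul_atTop hK
    simpa [Function.comp_def] using (Real.tendsto_exp_neg_atTop_nhds_zero.comp h).const_mul C
  have hcau : CauchySeq D := Metric.cauchySeq_iff'.2 fun ε hε ↦ by
    obtain ⟨N, hN, hN3⟩ := ((hlim.eventually_lt_const hε).and (Filter.eventually_ge_atTop 3)).exists
    exact ⟨N, fun n hn ↦ (H N hN3 n hn).trans_lt hN⟩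
  obtain ⟨c, hc⟩ := cauchySeq_tendsto_of_complete hcau
  refine ⟨c, K, hK, C, hC, fun X hX ↦ ?_⟩
  have h : |c - D X| ≤ C * Real.exp (-K * √(Real.log X)) :=
    le_of_tendsto (hc.sub_const (D X)).abs
      ((Filter.eventually_ge_atTop X).mono fun Y hY ↦ H X hX Y hY)
  rw [abs_sub_comm] at h
  rwa [← sub_sub]
end
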